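/- arXiv:1608.08299 — 4 statements merged into one kernel-verified Lean document; each statement's English description precedes it below -/
import Mathlib

section
/- Let (r_ℓ)_{ℓ≥1} be a sequence of positive real numbers with r_ℓ → ∞ and r_ℓ/ℓ → 0 as ℓ → ∞. Then there exist constants A > 0, η₁ > 0, η₂ > 0 and L ≥ 1 such that for all integers ℓ ≥ L: (1) for all θ with |θ| < η₂ (r_ℓ/ℓ)^{1/2}, |∑_m e^{i(2S_{ℓ,m}(θ) + mπ)}| ≤ A, where the sum is over integers m with ℓ − 2r_ℓ ≤ m ≤ ℓ − r_ℓ; and (2) for all θ with |θ| < π/2 − η₁ r_ℓ/ℓ, |∑_m e^{i(2S_{ℓ,m}(θ) + mπ)}| ≤ A, where the sum is over integers m with r_ℓ ≤ m ≤ 2r_ℓ. -/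
open Real Filter

noncomputable def Qlm (ℓ : ℕ) (m : ℤ) (θ : ℝ) : ℝ :=
  ((m : ℝ) ^ 2 - 1 / 4) / Real.cos θ ^ 2 - 1 / 4 - (ℓ : ℝ) * ((ℓ : ℝ) + 1)

noncomputable def Slm (ℓ : ℕ) (m : ℤ) (θ : ℝ) : ℝ :=
  ∫ t in (0:ℝ)..θ, Real.sqrt |Qlm ℓ m t|

/-- Kusmin-Landau type estimate: unimodular numbers whose consecutive ratios `-exp (-i d k)` have
slowly varying arguments bounded away from `2πℤ` have bounded partial sums. -/
theorem norm_sum_range_le_of_monotone_phase (z : ℕ → ℂ) (d : ℕ → ℝ) (n : ℕ)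
    (hz : ∀ k, ‖z k‖ = 1)
    (hratio : ∀ k, z (k + 1) = -z k * Complex.exp (Complex.I * ((-d k : ℝ) : ℂ)))
    (hmono : ∀ k, k < n → d k ≤ d (k + 1))
    (hd : ∀ k, k ≤ n → |d k| ≤ π / 2) :
    ‖∑ k ∈ Finset.range (n + 1), z k‖ ≤ π + 2 := by
  have hre : ∀ k, k ≤ n → 1 ≤ ‖1 + Complex.exp (Complex.I * ((-d k : ℝ) : ℂ))‖ := by
    intro k hk
    refine le_trans ?_ (Complex.re_le_norm _)
    have h := Real.cos_nonneg_of_mem_Icc (x := -d k)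
      ⟨by linarith [(abs_le.1 (hd k hk)).2], by linarith [(abs_le.1 (hd k hk)).1]⟩
    rw [mul_comm, Complex.add_re, Complex.exp_ofReal_mul_I_re, Complex.one_re]
    linarith
  set u : ℕ → ℂ := fun k => 1 + Complex.exp (Complex.I * ((-d k : ℝ) : ℂ)) with hu
  have hu0 : ∀ k, k ≤ n → u k ≠ 0 := fun k hk => by
    rw [← norm_pos_iff]; exact lt_of_lt_of_le one_pos (hre k hk)
  have hzu : ∀ k, k ≤ n → z k = (u k)⁻¹ * (z k - z (k + 1)) := by
    intro k hk
    have : z k - z (k + 1) = u k * z k := by rw [hratio, hu]; ring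
    rw [this, inv_mul_cancel_left₀ (hu0 k hk)]
  have hinv : ∀ k, k ≤ n → ‖(u k)⁻¹‖ ≤ 1 := fun k hk => by
    rw [norm_inv]; exact inv_le_one_of_one_le₀ (hre k hk)
  have hlip : ∀ k, k < n → ‖(u (k + 1))⁻¹ - (u k)⁻¹‖ ≤ d (k + 1) - d k := by
    intro k hk
    have h1 : (u (k + 1))⁻¹ - (u k)⁻¹ = (u (k + 1))⁻¹ * (u k)⁻¹ * (u k - u (k + 1)) := by
      have := hu0 k hk.le
      have := hu0 (k + 1) hk
      field_simp
    have h2 : u k - u (k + 1) = Complex.exp (Complex.I * ((-d (k + 1) : ℝ) : ℂ)) *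
        (Complex.exp (Complex.I * ((d (k + 1) - d k : ℝ) : ℂ)) - 1) := by
      rw [mul_sub, ← Complex.exp_add, hu]
      simp only [add_sub_add_left_eq_sub, mul_one]
      congr 2
      push_cast; ring
    rw [h1, h2, norm_mul, norm_mul, norm_mul, Complex.norm_exp_I_mul_ofReal, one_mul]
    have h3 := Real.norm_exp_I_mul_ofReal_sub_one_le (x := d (k + 1) - d k)
    rw [Real.norm_of_nonneg (sub_nonneg.2 (hmono k hk))] at h3
    calc _ ≤ 1 * 1 * (d (k + 1) - d k) := by
          gcongr
          · exact hinv _ hk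
          · exact hinv _ hk.le
      _ = _ := by ring
  have key : ∀ j, j ≤ n → ‖∑ k ∈ Finset.range (j + 1), z k - (u 0)⁻¹ * z 0
      + (u j)⁻¹ * z (j + 1)‖ ≤ d j - d 0 := by
    intro j
    induction j with
    | zero =>
      intro h
      have := hzu 0 h
      have h0 : z 0 - (u 0)⁻¹ * z 0 + (u 0)⁻¹ * z (0 + 1) = 0 := by
        linear_combination this
      simp only [zero_add, Finset.sum_range_one] at h0 ⊢
      rw [h0]; simp
    | succ j ih =>
      intro h
      have h1 := ih (by omega)
      have h2 : ∑ k ∈ Finset.range (j + 1 + 1), z k - (u 0)⁻¹ * z 0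
          + (u (j + 1))⁻¹ * z (j + 1 + 1) = (∑ k ∈ Finset.range (j + 1), z k - (u 0)⁻¹ * z 0
          + (u j)⁻¹ * z (j + 1)) + ((u (j + 1))⁻¹ - (u j)⁻¹) * z (j + 1) := by
        rw [Finset.sum_range_succ _ (j + 1)]
        linear_combination hzu (j + 1) h
      rw [h2]
      refine (norm_add_le _ _).trans ?_
      rw [norm_mul, hz, mul_one]
      linarith [hlip j (by omega)]
  have hn := key n le_rfl
  have h0 : ‖(u 0)⁻¹ * z 0‖ ≤ 1 := by rw [norm_mul, hz, mul_one]; exact hinv 0 (by omega)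
  have h1 : ‖(u n)⁻¹ * z (n + 1)‖ ≤ 1 := by rw [norm_mul, hz, mul_one]; exact hinv n le_rfl
  have hA := (abs_le.1 (hd n le_rfl)).2
  have hB := (abs_le.1 (hd 0 (by omega))).1
  calc ‖∑ k ∈ Finset.range (n + 1), z k‖
      = ‖(∑ k ∈ Finset.range (n + 1), z k - (u 0)⁻¹ * z 0 + (u n)⁻¹ * z (n + 1))
          + (u 0)⁻¹ * z 0 - (u n)⁻¹ * z (n + 1)‖ := by congr 1; ring
    _ ≤ _ := norm_sub_le _ _
    _ ≤ _ := add_le_add_left (norm_add_le _ _) _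
    _ ≤ π + 2 := by linarith

theorem Slm_neg (ℓ : ℕ) (m : ℤ) (θ : ℝ) : Slm ℓ m (-θ) = -Slm ℓ m θ := by
  have h := intervalIntegral.integral_comp_neg (a := 0) (b := θ)
    (fun t => Real.sqrt |Qlm ℓ m t|)
  simp only [Qlm, Real.cos_neg, neg_zero] at h
  rw [Slm, Slm, intervalIntegral.integral_symm]
  simp only [Qlm]
  rw [← h]

theorem norm_sum_exp_Slm_neg (ℓ : ℕ) (s : Finset ℤ) (θ : ℝ) :
    ‖∑ m ∈ s, Complex.exp (Complex.I * ((2 * Slm ℓ m (-θ) + (m : ℝ) * π : ℝ) : ℂ))‖ =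
    ‖∑ m ∈ s, Complex.exp (Complex.I * ((2 * Slm ℓ m θ + (m : ℝ) * π : ℝ) : ℂ))‖ := by
  rw [← RCLike.norm_conj, map_sum]
  congr 1
  refine Finset.sum_congr rfl fun m _ => ?_
  rw [← Complex.exp_conj, Slm_neg, map_mul, Complex.conj_I, Complex.conj_ofReal,
    Complex.exp_eq_exp_iff_exists_int]
  refine ⟨-m, ?_⟩
  push_cast
  ring

theorem norm_sum_exp_Slm_abs (ℓ : ℕ) (s : Finset ℤ) (θ : ℝ) :
    ‖∑ m ∈ s, Complex.exp (Complex.I * ((2 * Slm ℓ m |θ| + (m : ℝ) * π : ℝ) : ℂ))‖ =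
    ‖∑ m ∈ s, Complex.exp (Complex.I * ((2 * Slm ℓ m θ + (m : ℝ) * π : ℝ) : ℂ))‖ := by
  rcases abs_choice θ with h | h <;> rw [h]
  exact norm_sum_exp_Slm_neg ℓ s θ

/-- Uniform ellipticity: up to `θ` and for `1 ≤ m ≤ b`, the potential stays below `-G ^ 2`. -/
theorem Qlm_le_of_le {ℓ : ℕ} {m b : ℤ} {θ t G : ℝ} (hm : 1 ≤ m) (hmb : m ≤ b)
    (ht0 : 0 ≤ t) (htθ : t ≤ θ) (hθ : θ < π / 2)
    (hG : G ^ 2 ≤ ((ℓ : ℝ) + 1 / 2) ^ 2 - (b : ℝ) ^ 2 / Real.cos θ ^ 2) :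
    Qlm ℓ m t ≤ -G ^ 2 := by
  have hm' : (1 : ℝ) ≤ m := by exact_mod_cast hm
  have hmb' : (m : ℝ) ≤ b := by exact_mod_cast hmb
  have hcθ : 0 < Real.cos θ := Real.cos_pos_of_mem_Ioo ⟨by linarith [Real.pi_pos], hθ⟩
  have hct : Real.cos θ ≤ Real.cos t :=
    Real.cos_le_cos_of_nonneg_of_le_pi ht0 (by linarith) htθ
  have h : ((m : ℝ) ^ 2 - 1 / 4) / Real.cos t ^ 2 ≤ (b : ℝ) ^ 2 / Real.cos θ ^ 2 := by
    have : (m : ℝ) ^ 2 ≤ (b : ℝ) ^ 2 := by gcongr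
    gcongr
    linarith
  unfold Qlm
  nlinarith

theorem intervalIntegrable_sqrt_abs_Qlm (ℓ : ℕ) (m : ℤ) {θ : ℝ} (h0 : 0 ≤ θ) (hθ : θ < π / 2) :
    IntervalIntegrable (fun t => Real.sqrt |Qlm ℓ m t|) MeasureTheory.volume 0 θ := by
  apply ContinuousOn.intervalIntegrable
  rw [Set.uIcc_of_le h0]
  have hc : ∀ t ∈ Set.Icc 0 θ, Real.cos t ^ 2 ≠ 0 := fun t ht =>
    pow_ne_zero 2 (Real.cos_pos_of_mem_Ioo
      ⟨by linarith [Real.pi_pos, ht.1], by linarith [ht.2]⟩).ne'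
  unfold Qlm
  fun_prop (disch := assumption)

theorem sqrt_abs_Qlm_sub_mul_add {ℓ : ℕ} {m : ℤ} {t : ℝ} (h : Qlm ℓ m t ≤ 0)
    (h' : Qlm ℓ (m + 1) t ≤ 0) :
    (Real.sqrt |Qlm ℓ m t| - Real.sqrt |Qlm ℓ (m + 1) t|) *
      (Real.sqrt |Qlm ℓ m t| + Real.sqrt |Qlm ℓ (m + 1) t|) =
      (2 * (m : ℝ) + 1) / Real.cos t ^ 2 := by
  have h1 := Real.sq_sqrt (abs_nonneg (Qlm ℓ m t))
  have h2 := Real.sq_sqrt (abs_nonneg (Qlm ℓ (m + 1) t))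
  rw [abs_of_nonpos h] at h1 ⊢
  rw [abs_of_nonpos h'] at h2 ⊢
  have h3 : -Qlm ℓ m t - -Qlm ℓ (m + 1) t = (2 * (m : ℝ) + 1) / Real.cos t ^ 2 := by
    unfold Qlm
    push_cast
    ring
  linear_combination h1 - h2 + h3

theorem integral_inv_cos_sq {θ : ℝ} (h0 : 0 ≤ θ) (hθ : θ < π / 2) :
    IntervalIntegrable (fun t => 1 / Real.cos t ^ 2) MeasureTheory.volume 0 θ ∧
    ∫ t in (0:ℝ)..θ, 1 / Real.cos t ^ 2 = Real.tan θ := by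
  have hc : ∀ t ∈ Set.Icc 0 θ, Real.cos t ≠ 0 := fun t ht =>
    (Real.cos_pos_of_mem_Ioo ⟨by linarith [Real.pi_pos, ht.1], by linarith [ht.2]⟩).ne'
  have hi : IntervalIntegrable (fun t => 1 / Real.cos t ^ 2) MeasureTheory.volume 0 θ := by
    apply ContinuousOn.intervalIntegrable
    rw [Set.uIcc_of_le h0]
    have hc2 : ∀ t ∈ Set.Icc 0 θ, Real.cos t ^ 2 ≠ 0 := fun t ht => pow_ne_zero 2 (hc t ht)
    fun_prop (disch := assumption)
  refine ⟨hi, ?_⟩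
  rw [intervalIntegral.integral_eq_sub_of_hasDerivAt (f := Real.tan) _ hi, Real.tan_zero, sub_zero]
  rw [Set.uIcc_of_le h0]
  exact fun t ht => Real.hasDerivAt_tan (hc t ht)

section Differences

variable {ℓ : ℕ} {b : ℤ} {θ G : ℝ}

theorem Slm_sub_Slm_succ (ℓ : ℕ) (m : ℤ) (h0 : 0 ≤ θ) (hθ : θ < π / 2) :
    Slm ℓ m θ - Slm ℓ (m + 1) θ =
      ∫ t in (0:ℝ)..θ, (Real.sqrt |Qlm ℓ m t| - Real.sqrt |Qlm ℓ (m + 1) t|) :=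
  (intervalIntegral.integral_sub (intervalIntegrable_sqrt_abs_Qlm ℓ m h0 hθ)
    (intervalIntegrable_sqrt_abs_Qlm ℓ (m + 1) h0 hθ)).symm

theorem le_sqrt_abs_Qlm {m : ℤ} {t : ℝ} (h : Qlm ℓ m t ≤ -G ^ 2) :
    G ≤ Real.sqrt |Qlm ℓ m t| := by
  apply Real.le_sqrt_of_sq_le
  rw [abs_of_nonpos (by nlinarith)]
  linarith

theorem Slm_sub_Slm_succ_bounds (hG0 : 0 < G) (h0 : 0 ≤ θ) (hθ : θ < π / 2)
    (hG : G ^ 2 ≤ ((ℓ : ℝ) + 1 / 2) ^ 2 - (b : ℝ) ^ 2 / Real.cos θ ^ 2)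
    {m : ℤ} (hm : 1 ≤ m) (hmb : m + 1 ≤ b) :
    0 ≤ Slm ℓ m θ - Slm ℓ (m + 1) θ ∧
      Slm ℓ m θ - Slm ℓ (m + 1) θ ≤ (2 * (b : ℝ) + 1) / (2 * G) * Real.tan θ := by
  have hpt : ∀ t ∈ Set.Icc 0 θ, 0 ≤ Real.sqrt |Qlm ℓ m t| - Real.sqrt |Qlm ℓ (m + 1) t| ∧
      Real.sqrt |Qlm ℓ m t| - Real.sqrt |Qlm ℓ (m + 1) t| ≤
        (2 * (b : ℝ) + 1) / (2 * G) * (1 / Real.cos t ^ 2) := by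
    intro t ht
    have q1 := Qlm_le_of_le hm (by omega : m ≤ b) ht.1 ht.2 hθ hG
    have q2 := Qlm_le_of_le (by omega : 1 ≤ m + 1) hmb ht.1 ht.2 hθ hG
    have g1 := le_sqrt_abs_Qlm q1
    have g2 := le_sqrt_abs_Qlm q2
    have e := sqrt_abs_Qlm_sub_mul_add (ℓ := ℓ) (m := m) (t := t) (by nlinarith) (by nlinarith)
    have hct : 0 < Real.cos t :=
      Real.cos_pos_of_mem_Ioo ⟨by linarith [Real.pi_pos, ht.1], by linarith [ht.2]⟩
    have hm' : (1 : ℝ) ≤ m := by exact_mod_cast hm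
    have hmb' : (m : ℝ) + 1 ≤ b := by exact_mod_cast hmb
    set x := Real.sqrt |Qlm ℓ m t|
    set y := Real.sqrt |Qlm ℓ (m + 1) t|
    have hpos : 0 ≤ x - y := by
      have : 0 < (2 * (m : ℝ) + 1) / Real.cos t ^ 2 := by positivity
      rw [← e] at this
      exact (pos_of_mul_pos_left this (by linarith)).le
    refine ⟨hpos, ?_⟩
    rw [div_mul_eq_mul_div, le_div_iff₀ (by positivity), mul_one_div]
    calc (x - y) * (2 * G) ≤ (x - y) * (x + y) := by gcongr; linarith
      _ = _ := e
      _ ≤ _ := by gcongr; linarith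
  have hi := (intervalIntegrable_sqrt_abs_Qlm ℓ m h0 hθ).sub
    (intervalIntegrable_sqrt_abs_Qlm ℓ (m + 1) h0 hθ)
  obtain ⟨hi2, ht⟩ := integral_inv_cos_sq h0 hθ
  rw [Slm_sub_Slm_succ ℓ m h0 hθ]
  refine ⟨intervalIntegral.integral_nonneg h0 fun t ht => (hpt t ht).1, ?_⟩
  rw [← ht, ← intervalIntegral.integral_const_mul]
  exact intervalIntegral.integral_mono_on h0 hi (hi2.const_mul _) fun t ht => (hpt t ht).2

theorem Slm_sub_Slm_succ_le (hG0 : 0 < G) (h0 : 0 ≤ θ) (hθ : θ < π / 2)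
    (hG : G ^ 2 ≤ ((ℓ : ℝ) + 1 / 2) ^ 2 - (b : ℝ) ^ 2 / Real.cos θ ^ 2)
    {m : ℤ} (hm : 1 ≤ m) (hmb : m + 1 + 1 ≤ b) :
    Slm ℓ m θ - Slm ℓ (m + 1) θ ≤ Slm ℓ (m + 1) θ - Slm ℓ (m + 1 + 1) θ := by
  have hi := fun m : ℤ => (intervalIntegrable_sqrt_abs_Qlm ℓ m h0 hθ).sub
    (intervalIntegrable_sqrt_abs_Qlm ℓ (m + 1) h0 hθ)
  rw [Slm_sub_Slm_succ ℓ m h0 hθ, Slm_sub_Slm_succ ℓ (m + 1) h0 hθ]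
  refine intervalIntegral.integral_mono_on h0 (hi m) (hi (m + 1)) fun t ht => ?_
  have q1 := Qlm_le_of_le hm (by omega : m ≤ b) ht.1 ht.2 hθ hG
  have q2 := Qlm_le_of_le (by omega : 1 ≤ m + 1) (by omega) ht.1 ht.2 hθ hG
  have q3 := Qlm_le_of_le (by omega : 1 ≤ m + 1 + 1) hmb ht.1 ht.2 hθ hG
  have g1 := le_sqrt_abs_Qlm q1
  have g2 := le_sqrt_abs_Qlm q2
  have g3 := le_sqrt_abs_Qlm q3
  have e1 := sqrt_abs_Qlm_sub_mul_add (ℓ := ℓ) (m := m) (t := t) (by nlinarith) (by nlinarith)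
  have e2 := sqrt_abs_Qlm_sub_mul_add (ℓ := ℓ) (m := m + 1) (t := t) (by nlinarith) (by nlinarith)
  have hct : 0 < Real.cos t :=
    Real.cos_pos_of_mem_Ioo ⟨by linarith [Real.pi_pos, ht.1], by linarith [ht.2]⟩
  have hm' : (1 : ℝ) ≤ m := by exact_mod_cast hm
  set x := Real.sqrt |Qlm ℓ m t|
  set y := Real.sqrt |Qlm ℓ (m + 1) t|
  set w := Real.sqrt |Qlm ℓ (m + 1 + 1) t|
  have hlt : (x - y) * (x + y) ≤ (y - w) * (y + w) := by
    rw [e1, e2]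
    push_cast
    gcongr
    linarith
  have hxy : 0 ≤ x - y := by
    have : 0 < (2 * (m : ℝ) + 1) / Real.cos t ^ 2 := by positivity
    rw [← e1] at this
    exact (pos_of_mul_pos_left this (by linarith)).le
  by_contra hcon
  have hcon : y - w < x - y := not_le.1 hcon
  have : (y - w) * (y + w) < (x - y) * (x + y) := by
    have hyw : 0 ≤ y - w := by
      by_contra hneg
      have : (y - w) * (y + w) < 0 := mul_neg_of_neg_of_pos (not_le.1 hneg) (by linarith)
      nlinarith
    calc (y - w) * (y + w) ≤ (y - w) * (x + y) := by gcongr ?_ * ?_; linarith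
      _ < _ := by gcongr; linarith
  linarith

end Differences

theorem norm_sum_exp_Slm_le {ℓ : ℕ} {a b : ℤ} {θ G : ℝ} (ha : 1 ≤ a) (hG0 : 0 < G)
    (h0 : 0 ≤ θ) (hθ : θ < π / 2)
    (hG : G ^ 2 ≤ ((ℓ : ℝ) + 1 / 2) ^ 2 - (b : ℝ) ^ 2 / Real.cos θ ^ 2)
    (htan : (2 * (b : ℝ) + 1) * Real.tan θ ≤ G * (π / 2)) :
    ‖∑ m ∈ Finset.Icc a b,
      Complex.exp (Complex.I * ((2 * Slm ℓ m θ + (m : ℝ) * π : ℝ) : ℂ))‖ ≤ π + 3 := by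
  rcases lt_trichotomy a b with hab | hab | hab
  · obtain ⟨n, rfl⟩ : ∃ n : ℕ, b = a + (n + 1 : ℕ) := ⟨(b - a - 1).toNat, by omega⟩
    set f : ℤ → ℂ := fun m => Complex.exp (Complex.I * ((2 * Slm ℓ m θ + (m : ℝ) * π : ℝ) : ℂ))
      with hf
    have hsum : ∑ m ∈ Finset.Icc a (a + (n + 1 : ℕ)), f m
        = ∑ k ∈ Finset.range (n + 1 + 1), f (a + k) := by
      symm
      refine Finset.sum_bij (fun k _ => a + (k : ℤ)) ?_ ?_ ?_ ?_
      · intro k hk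
        simp only [Finset.mem_range, Finset.mem_Icc] at hk ⊢
        omega
      · intro k _ j _ h
        have h : a + (k : ℤ) = a + j := h
        omega
      · intro m hm
        rw [Finset.mem_Icc] at hm
        refine ⟨(m - a).toNat, ?_, ?_⟩
        · rw [Finset.mem_range]; omega
        · omega
      · intro _ _; rfl
    rw [hsum, Finset.sum_range_succ]
    have hunit : ∀ m, ‖f m‖ = 1 := fun m => Complex.norm_exp_I_mul_ofReal _
    refine (norm_add_le _ _).trans ?_
    rw [hunit]
    have := norm_sum_range_le_of_monotone_phase (fun k => f (a + k))
      (fun k => 2 * (Slm ℓ (a + k) θ - Slm ℓ (a + k + 1) θ)) n (fun k => hunit _) ?_ ?_ ?_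
    · linarith
    · intro k
      simp only [hf]
      rw [neg_mul, ← Complex.exp_add, ← mul_neg_one, ← Complex.exp_pi_mul_I, ← Complex.exp_add]
      congr 1
      push_cast
      rw [← add_assoc]
      ring
    · intro k hk
      have := Slm_sub_Slm_succ_le hG0 h0 hθ hG (m := a + k) (by omega) (by push_cast; omega)
      push_cast
      rw [← add_assoc]
      linarith
    · intro k hk
      obtain ⟨h1, h2⟩ := Slm_sub_Slm_succ_bounds hG0 h0 hθ hG (m := a + k) (by omega)
        (by push_cast; omega)
      rw [abs_of_nonneg (by linarith)]
      rw [div_mul_eq_mul_div, le_div_iff₀ (by positivity)] at h2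
      have h3 := h2.trans htan
      have : Slm ℓ (a + k) θ - Slm ℓ (a + k + 1) θ ≤ π / 4 := by
        by_contra hcon
        nlinarith [not_le.1 hcon]
      linarith
  · subst hab
    rw [Finset.Icc_self, Finset.sum_singleton, Complex.norm_exp_I_mul_ofReal]
    linarith [Real.pi_pos]
  · rw [Finset.Icc_eq_empty (not_le.2 hab), Finset.sum_empty, norm_zero]
    linarith [Real.pi_pos]

theorem norm_sum_exp_Slm_near_top_le {ℓ : ℕ} {ρ θ : ℝ} (hρ1 : 1 ≤ ρ) (hρℓ : ρ < 1 / 4 * ℓ)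
    (hθ : |θ| < 1 / 4 * Real.sqrt (ρ / (ℓ : ℝ))) :
    ‖∑ m ∈ Finset.Icc ⌈(ℓ : ℝ) - 2 * ρ⌉ ⌊(ℓ : ℝ) - ρ⌋,
      Complex.exp (Complex.I * ((2 * Slm ℓ m θ + (m : ℝ) * π : ℝ) : ℂ))‖ ≤ π + 3 := by
  have hρ0 : 0 < ρ := by linarith
  have hℓ0 : (0 : ℝ) < ℓ := by linarith
  have hpi := Real.pi_gt_three
  rw [← norm_sum_exp_Slm_abs]
  have h0 := abs_nonneg θ
  set x := |θ|
  have hs0 := Real.sqrt_nonneg (ρ / ℓ)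
  have hs2 : Real.sqrt (ρ / ℓ) ^ 2 = ρ / ℓ := Real.sq_sqrt (by positivity)
  have hsℓ : Real.sqrt (ρ / ℓ) * ℓ = Real.sqrt (ρ * ℓ) := by
    rw [show ρ * ℓ = (ρ / ℓ) * (ℓ : ℝ) ^ 2 by field_simp, Real.sqrt_mul (by positivity),
      Real.sqrt_sq hℓ0.le]
  set s := Real.sqrt (ρ / ℓ)
  have hrl : ρ / ℓ < 1 / 4 := (div_lt_iff₀ hℓ0).2 hρℓ
  have hs1 : s ≤ 1 := by nlinarith
  have hsl2 : s ^ 2 * ℓ = ρ := by rw [hs2]; field_simp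
  have hx1 : x < π / 2 := by linarith
  have hb : ((⌊(ℓ : ℝ) - ρ⌋ : ℤ) : ℝ) ≤ ℓ - ρ := Int.floor_le _
  have hc0 : 0 < Real.cos x := Real.cos_pos_of_mem_Ioo ⟨by linarith, hx1⟩
  have hsin := Real.sin_le h0
  have hsin0 : 0 ≤ Real.sin x := Real.sin_nonneg_of_nonneg_of_le_pi h0 (by linarith)
  have hcs := Real.sin_sq_add_cos_sq x
  have hc2 : 1 - s ^ 2 / 16 ≤ Real.cos x ^ 2 := by nlinarith
  have hc1 : Real.cos x ^ 2 ≤ 1 := by nlinarith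
  have hchalf : 1 / 2 ≤ Real.cos x := by nlinarith
  have ha : 1 ≤ ⌈(ℓ : ℝ) - 2 * ρ⌉ := by
    rw [Int.one_le_ceil_iff]; linarith
  by_cases hab : ⌊(ℓ : ℝ) - ρ⌋ < ⌈(ℓ : ℝ) - 2 * ρ⌉
  · rw [Finset.Icc_eq_empty (not_le.2 hab), Finset.sum_empty, norm_zero]
    positivity
  have hb1 : (1 : ℝ) ≤ ((⌊(ℓ : ℝ) - ρ⌋ : ℤ) : ℝ) := by
    exact_mod_cast ha.trans (not_lt.1 hab)
  refine norm_sum_exp_Slm_le (G := s * ℓ) ha ?_ h0 hx1 ?_ ?_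
  · rw [hsℓ]; positivity
  · set B := ((⌊(ℓ : ℝ) - ρ⌋ : ℤ) : ℝ)
    rw [le_sub_iff_add_le, ← le_sub_iff_add_le', div_le_iff₀ (by positivity)]
    have hB2 : B ^ 2 ≤ (ℓ - ρ) ^ 2 := by gcongr
    have e : (s * ℓ) ^ 2 = ρ * ℓ := by rw [← hsl2]; ring
    rw [e]
    have h1 : (ℓ - ρ) ^ 2 ≤ (ℓ * ℓ - ρ * ℓ) * (1 - s ^ 2 / 16) := by
      have : (ℓ * ℓ - ρ * ℓ) * (1 - s ^ 2 / 16)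
          = ℓ * ℓ - ρ * ℓ - ρ * ℓ / 16 + ρ * ρ / 16 := by
        rw [← hsl2]; ring
      rw [this]
      nlinarith
    have h2 : (ℓ * ℓ - ρ * ℓ) * (1 - s ^ 2 / 16) ≤
        (((ℓ : ℝ) + 1 / 2) ^ 2 - ρ * ℓ) * Real.cos x ^ 2 := by
      gcongr
      · nlinarith
      · nlinarith
      · nlinarith
    linarith
  · set B := ((⌊(ℓ : ℝ) - ρ⌋ : ℤ) : ℝ)
    have ht : Real.tan x ≤ s / 2 := by
      rw [Real.tan_eq_sin_div_cos, div_le_iff₀ hc0]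
      nlinarith
    have ht0 : 0 ≤ Real.tan x := Real.tan_nonneg_of_nonneg_of_le_pi_div_two h0 hx1.le
    calc (2 * B + 1) * Real.tan x ≤ (2 * ℓ) * (s / 2) :=
          mul_le_mul (by linarith) ht ht0 (by positivity)
      _ = s * ℓ * 1 := by ring
      _ ≤ s * ℓ * (π / 2) :=
        mul_le_mul_of_nonneg_left (by linarith) (by positivity)

theorem norm_sum_exp_Slm_small_le {ℓ : ℕ} {ρ θ : ℝ} (hρ1 : 1 ≤ ρ) (hℓ0 : (0 : ℝ) < ℓ)
    (hθ : |θ| < π / 2 - 4 * π * ρ / (ℓ : ℝ)) :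
    ‖∑ m ∈ Finset.Icc ⌈ρ⌉ ⌊2 * ρ⌋,
      Complex.exp (Complex.I * ((2 * Slm ℓ m θ + (m : ℝ) * π : ℝ) : ℂ))‖ ≤ π + 3 := by
  have hρ0 : 0 < ρ := by linarith
  have hpi := Real.pi_gt_three
  rw [← norm_sum_exp_Slm_abs]
  have h0 := abs_nonneg θ
  set x := |θ|
  have hy : 4 * π * ρ / ℓ < π / 2 - x := by linarith
  have hy0 : 0 < 4 * π * ρ / ℓ := by positivity
  have hx1 : x < π / 2 := by linarith
  have hc0 : 0 < Real.cos x := Real.cos_pos_of_mem_Ioo ⟨by linarith, hx1⟩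
  have hc : 8 * ρ / ℓ ≤ Real.cos x := by
    rw [← Real.sin_pi_div_two_sub]
    refine le_trans ?_ (Real.mul_le_sin (by linarith) (by linarith))
    calc 8 * ρ / ℓ = 2 / π * (4 * π * ρ / ℓ) := by field_simp; norm_num
      _ ≤ _ := by gcongr
  have hc' : 8 * ρ ≤ Real.cos x * ℓ := (div_le_iff₀ hℓ0).1 hc
  have hb : ((⌊2 * ρ⌋ : ℤ) : ℝ) ≤ 2 * ρ := Int.floor_le _
  have hb0 : (0 : ℝ) ≤ ((⌊2 * ρ⌋ : ℤ) : ℝ) := by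
    exact_mod_cast Int.floor_nonneg.2 (by linarith)
  have ha : 1 ≤ ⌈ρ⌉ := by rw [Int.one_le_ceil_iff]; exact hρ0
  set b := ⌊2 * ρ⌋
  refine norm_sum_exp_Slm_le (G := ℓ / 2) ha (by positivity) h0 hx1 ?_ ?_
  · have : (b : ℝ) ^ 2 / Real.cos x ^ 2 ≤ (ℓ / 4) ^ 2 := by
      rw [← div_pow]
      refine pow_le_pow_left₀ (by positivity) ?_ 2
      rw [div_le_iff₀ hc0]
      linarith
    nlinarith
  · have ht : Real.tan x ≤ 1 / Real.cos x := by
      rw [Real.tan_eq_sin_div_cos]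
      gcongr
      exact Real.sin_le_one x
    calc (2 * (b : ℝ) + 1) * Real.tan x ≤ (5 * ρ) * (1 / Real.cos x) :=
          mul_le_mul (by linarith) ht
            (Real.tan_nonneg_of_nonneg_of_le_pi_div_two h0 hx1.le) (by positivity)
      _ ≤ 5 * ℓ / 8 := by
          rw [mul_one_div, div_le_iff₀ hc0]
          linarith
      _ ≤ ℓ / 2 * (π / 2) := by nlinarith

/-- Control of the oscillations: boundedness of the exponential sums of the WKB phases. -/
theorem stmt_5 (r : ℕ → ℝ) (hrpos : ∀ ℓ, 0 < r ℓ)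
    (hrinf : Tendsto r atTop atTop)
    (hr0 : Tendsto (fun ℓ : ℕ => r ℓ / (ℓ : ℝ)) atTop (nhds 0)) :
    ∃ A > (0:ℝ), ∃ η₁ > (0:ℝ), ∃ η₂ > (0:ℝ), ∃ L : ℕ, 1 ≤ L ∧
      ∀ ℓ : ℕ, L ≤ ℓ →
        (∀ θ : ℝ, |θ| < η₂ * Real.sqrt (r ℓ / (ℓ : ℝ)) →
          ‖∑ m ∈ Finset.Icc ⌈(ℓ : ℝ) - 2 * r ℓ⌉ ⌊(ℓ : ℝ) - r ℓ⌋,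
              Complex.exp (Complex.I * ((2 * Slm ℓ m θ + (m : ℝ) * π : ℝ) : ℂ))‖ ≤ A) ∧
        (∀ θ : ℝ, |θ| < π / 2 - η₁ * r ℓ / (ℓ : ℝ) →
          ‖∑ m ∈ Finset.Icc ⌈r ℓ⌉ ⌊2 * r ℓ⌋,
              Complex.exp (Complex.I * ((2 * Slm ℓ m θ + (m : ℝ) * π : ℝ) : ℂ))‖ ≤ A) := by
  have hev : ∀ᶠ ℓ : ℕ in atTop, 1 ≤ r ℓ ∧ r ℓ / (ℓ : ℝ) < 1 / 4 :=
    (hrinf.eventually_ge_atTop 1).and (hr0.eventually_lt_const (by norm_num))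
  obtain ⟨N, hN⟩ := eventually_atTop.1 hev
  refine ⟨π + 3, by positivity, 4 * π, by positivity, 1 / 4, by norm_num, max N 1,
    le_max_right _ _, fun ℓ hℓ => ?_⟩
  obtain ⟨hr1, hrl⟩ := hN ℓ ((le_max_left _ _).trans hℓ)
  have hℓ1 : (1 : ℝ) ≤ ℓ := by exact_mod_cast (le_max_right _ _).trans hℓ
  have hℓ0 : (0 : ℝ) < ℓ := by linarith
  have hrl' : r ℓ < 1 / 4 * ℓ := (div_lt_iff₀ hℓ0).1 hrl
  exact ⟨fun θ hθ => norm_sum_exp_Slm_near_top_le hr1 hrl' hθ,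
    fun θ hθ => norm_sum_exp_Slm_small_le hr1 hℓ0 hθ⟩
end

section
/- Let (r_ℓ)_{ℓ≥1} be a sequence of positive real numbers with r_ℓ → ∞ and r_ℓ/ℓ → 0 as ℓ → ∞. Then there exists a constant C > 0, independent of η₁, such that for every η₁ ≥ 2 there exists L ≥ 1 so that for all integers ℓ ≥ L, all integers m with r_ℓ ≤ m ≤ 2r_ℓ, and all θ ∈ [0, π/2 − η₁ r_ℓ/ℓ], one has 0 ≤ S_{ℓ,m−1}(θ) − S_{ℓ,m}(θ) ≤ C/η₁. -/
open Real Filter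

lemma sqrt_abs_sub_sqrt_abs_le {p q : ℝ} (hpq : p ≤ q) :
    √|p| - √|q| ≤ (q - p) / √(-p) := by
  rcases le_or_gt 0 p with hp | hp
  · rw [sqrt_eq_zero_of_nonpos (by linarith : -p ≤ 0), div_zero, sub_nonpos]
    apply sqrt_le_sqrt
    rwa [abs_of_nonneg hp, abs_of_nonneg (hp.trans hpq)]
  · have hs : 0 < √(-p) := sqrt_pos.2 (by linarith)
    have hsq : √(-p) * √(-p) = -p := mul_self_sqrt (by linarith)
    rw [le_div_iff₀ hs, abs_of_neg hp]
    rcases le_or_gt 0 q with hq | hq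
    · nlinarith [mul_nonneg (sqrt_nonneg |q|) hs.le]
    · rw [abs_of_neg hq]
      have h1 : √(-q) ≤ √(-p) := sqrt_le_sqrt (by linarith)
      have h2 : √(-q) * √(-q) = -q := mul_self_sqrt (by linarith)
      nlinarith [mul_le_mul_of_nonneg_left h1 (sqrt_nonneg (-q))]

lemma div_two_sqrt_le_sqrt_abs_sub_sqrt_abs {p q B : ℝ} (hpq : p ≤ q) (hq : q ≤ 0)
    (hB : 0 < B) (hpB : -p ≤ B) :
    (q - p) / (2 * √B) ≤ √|p| - √|q| := by
  have hs : 0 < √B := sqrt_pos.2 hB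
  rw [div_le_iff₀ (by positivity), abs_of_nonpos hq, abs_of_nonpos (hpq.trans hq)]
  have h1 : √(-q) ≤ √(-p) := sqrt_le_sqrt (by linarith)
  have h2 : √(-p) ≤ √B := sqrt_le_sqrt hpB
  have h3 : √(-q) * √(-q) = -q := mul_self_sqrt (by linarith)
  have h4 : √(-p) * √(-p) = -p := mul_self_sqrt (by linarith)
  nlinarith [mul_nonneg (sub_nonneg.2 h1) (by linarith : 0 ≤ 2 * √B - √(-p) - √(-q))]

lemma neg_div_sqrt_le_sqrt_abs_sub_sqrt_abs {p q : ℝ} (hpq : p ≤ q) (hq : 0 < q) :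
    -((q - p) / √q) ≤ √|p| - √|q| := by
  have hs : 0 < √q := sqrt_pos.2 hq
  have hsq : √q * √q = q := mul_self_sqrt hq.le
  rw [neg_le, neg_sub, le_div_iff₀ hs, abs_of_pos hq]
  rcases le_or_gt 0 p with hp | hp
  · rw [abs_of_nonneg hp]
    have h1 : √p ≤ √q := sqrt_le_sqrt hpq
    have h2 : √p * √p = p := mul_self_sqrt hp
    nlinarith [mul_le_mul_of_nonneg_left h1 (sqrt_nonneg p)]
  · nlinarith [mul_nonneg (sqrt_nonneg |p|) hs.le]

lemma arcsin_le_pi_div_two_mul {x : ℝ} (hx : 0 ≤ x) : arcsin x ≤ π / 2 * x := by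
  have h1 := mul_le_sin (arcsin_nonneg.2 hx) (arcsin_le_pi_div_two x)
  have h2 : sin (arcsin x) ≤ x := by
    rcases le_or_gt x 1 with h | h
    · rw [sin_arcsin (by linarith) h]
    · exact (sin_le_one _).trans h.le
  have hpi := pi_pos
  calc arcsin x = π / 2 * (2 / π * arcsin x) := by field_simp
    _ ≤ π / 2 * x := by gcongr; exact h1.trans h2

lemma one_div_cos_sq {t : ℝ} (h : cos t ≠ 0) : 1 / cos t ^ 2 = 1 + tan t ^ 2 := by
  rw [← inv_one_add_tan_sq h, one_div, inv_inv]

lemma continuousOn_tan_Icc {α β : ℝ} (hα : 0 ≤ α) (hβ : β < π / 2) :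
    ContinuousOn tan (Set.Icc α β) :=
  continuousOn_tan_Ioo.mono fun t ht => ⟨by linarith [ht.1, pi_pos], by linarith [ht.2]⟩

lemma continuousOn_div_cos_sq_sub (a B : ℝ) {α β : ℝ} (hα : 0 ≤ α) (hβ : β < π / 2) :
    ContinuousOn (fun t => a / cos t ^ 2 - B) (Set.Icc α β) := by
  refine ((continuousOn_const.div (by fun_prop) fun t ht => ?_)).sub continuousOn_const
  exact pow_ne_zero 2
    (cos_pos_of_mem_Ioo ⟨by linarith [ht.1, pi_pos], by linarith [ht.2]⟩).ne'

lemma continuousOn_sqrt_abs_div_cos_sq_sub (a B : ℝ) {α β : ℝ} (hα : 0 ≤ α) (hβ : β < π / 2) :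
    ContinuousOn (fun t => √|a / cos t ^ 2 - B|) (Set.Icc α β) :=
  (continuousOn_div_cos_sq_sub a B hα hβ).abs.sqrt

lemma integral_sqrt_abs_sub_le {a b B θ : ℝ} (ha : 0 < a) (hab : a ≤ b) (haB : a < B)
    (hθ0 : 0 ≤ θ) (hθ : θ < π / 2) :
    ∫ t in (0 : ℝ)..θ, (√|a / cos t ^ 2 - B| - √|b / cos t ^ 2 - B|) ≤
      (b - a) * (π / 2) * tan θ / √(B - a) := by
  have hsa : 0 < √a := sqrt_pos.2 ha
  have hsB : 0 < √(B - a) := sqrt_pos.2 (by linarith)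
  have hcos : ∀ t ∈ Set.Icc 0 θ, 0 < cos t := fun t ht =>
    cos_pos_of_mem_Ioo ⟨by linarith [ht.1, pi_pos], by linarith [ht.2]⟩
  have htan : ∀ t ∈ Set.Icc 0 θ, 0 ≤ tan t := fun t ht =>
    tan_nonneg_of_nonneg_of_le_pi_div_two ht.1 (by linarith [ht.2])
  have hcont : ContinuousOn (fun t => (b - a) / √a * arcsin (√a * tan t / √(B - a)))
      (Set.Icc 0 θ) :=
    continuousOn_const.mul (continuous_arcsin.comp_continuousOn
      ((continuousOn_const.mul (continuousOn_tan_Icc le_rfl hθ)).div_const _))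
  have key := intervalIntegral.integral_le_sub_of_hasDeriv_right_of_le hθ0 hcont
    (g' := fun t => (b - a) / √a *
      (1 / √(1 - (√a * tan t / √(B - a)) ^ 2) * (√a * (1 / cos t ^ 2) / √(B - a))))
    (φ := fun t => √|a / cos t ^ 2 - B| - √|b / cos t ^ 2 - B|) ?_ ?_ ?_
  · refine key.trans ?_
    have h := arcsin_le_pi_div_two_mul
      (div_nonneg (mul_nonneg hsa.le (htan θ ⟨hθ0, le_rfl⟩)) hsB.le)
    simp only [tan_zero, mul_zero, zero_div, arcsin_zero, sub_zero]
    calc (b - a) / √a * arcsin (√a * tan θ / √(B - a))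
        ≤ (b - a) / √a * (π / 2 * (√a * tan θ / √(B - a))) := by
          apply mul_le_mul_of_nonneg_left h (div_nonneg (by linarith) hsa.le)
      _ = _ := by field_simp
  · intro t ht
    have ht' : t ∈ Set.Icc 0 θ := ⟨ht.1.le, ht.2.le⟩
    have hx : √a * tan t / √(B - a) ≠ -1 := by
      have : 0 ≤ √a * tan t / √(B - a) := div_nonneg (mul_nonneg hsa.le (htan t ht')) hsB.le
      linarith
    have h1 : HasDerivWithinAt (fun t => √a * tan t / √(B - a))
        (√a * (1 / cos t ^ 2) / √(B - a)) (Set.Ioo t (π / 2)) t :=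
      (((hasDerivAt_tan (hcos t ht').ne').const_mul _).div_const _).hasDerivWithinAt
    have h2 := (hasDerivWithinAt_arcsin_Ici hx).comp t h1 (fun s hs => by
      have := tan_lt_tan_of_nonneg_of_lt_pi_div_two ht.1.le hs.2 hs.1
      simp only [Set.mem_Ici]
      gcongr)
    exact (h2.mono_of_mem_nhdsWithin (Ioo_mem_nhdsGT (by linarith [ht.2]))).const_mul _
  · exact ((continuousOn_sqrt_abs_div_cos_sq_sub a B le_rfl hθ).sub
      (continuousOn_sqrt_abs_div_cos_sq_sub b B le_rfl hθ)).integrableOn_Icc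
  · intro t ht
    have hc := hcos t ⟨ht.1.le, ht.2.le⟩
    have h := sqrt_abs_sub_sqrt_abs_le
      (p := a / cos t ^ 2 - B) (q := b / cos t ^ 2 - B) (by gcongr)
    refine h.trans (le_of_eq ?_)
    have hs : √(-(a / cos t ^ 2 - B)) = √(1 - (√a * tan t / √(B - a)) ^ 2) * √(B - a) := by
      rw [← sqrt_mul' _ (by linarith : 0 ≤ B - a)]
      congr 1
      rw [div_pow, mul_pow, sq_sqrt ha.le, sq_sqrt (by linarith : 0 ≤ B - a), div_eq_mul_one_div a,
        one_div_cos_sq hc.ne']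
      have : B - a ≠ 0 := by linarith
      field_simp
      ring
    rw [hs]
    rcases eq_or_ne (√(1 - (√a * tan t / √(B - a)) ^ 2)) 0 with h0 | h0
    · simp [h0]
    · generalize √(1 - (√a * tan t / √(B - a)) ^ 2) = R at h0
      field_simp
      ring

lemma integral_sqrt_abs_sub_nonneg_of_nonpos {a b B θ : ℝ} (hab : a ≤ b) (hb : 0 ≤ b)
    (hθ0 : 0 ≤ θ) (hθ : θ < π / 2) (hq : b / cos θ ^ 2 ≤ B) :
    0 ≤ ∫ t in (0 : ℝ)..θ, (√|a / cos t ^ 2 - B| - √|b / cos t ^ 2 - B|) := by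
  refine intervalIntegral.integral_nonneg hθ0 fun t ht => ?_
  have hcθ : 0 < cos θ := cos_pos_of_mem_Ioo ⟨by linarith [pi_pos], hθ⟩
  have hc : cos θ ≤ cos t := cos_le_cos_of_nonneg_of_le_pi ht.1 (by linarith [pi_pos]) ht.2
  have h1 : b / cos t ^ 2 ≤ b / cos θ ^ 2 := by gcongr
  have h2 : a / cos t ^ 2 ≤ b / cos t ^ 2 := by gcongr
  rw [sub_nonneg, abs_of_nonpos (by linarith), abs_of_nonpos (by linarith)]
  exact sqrt_le_sqrt (by linarith)

lemma integral_sqrt_abs_sub_nonneg {a b B E θ : ℝ} (ha : 0 < a) (hab : a ≤ b) (hbB : b < B)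
    (hθ0 : 0 ≤ θ) (hθ : θ < π / 2) (hE : 0 ≤ E) (hQ : b / cos θ ^ 2 - B ≤ E ^ 2)
    (hEB : 2 * √B * E ≤ B - b) :
    0 ≤ ∫ t in (0 : ℝ)..θ, (√|a / cos t ^ 2 - B| - √|b / cos t ^ 2 - B|) := by
  have hb : 0 < b := ha.trans_le hab
  rcases le_or_gt (b / cos θ ^ 2) B with hq | hq
  · exact integral_sqrt_abs_sub_nonneg_of_nonpos hab hb.le hθ0 hθ hq
  have hcos : ∀ t, 0 ≤ t → t ≤ θ → 0 < cos t := fun t h0 h1 =>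
    cos_pos_of_mem_Ioo ⟨by linarith [pi_pos], by linarith⟩
  have hsec : ∀ t, 0 ≤ t → t ≤ θ → ∀ c : ℝ, c / cos t ^ 2 = c * (1 + tan t ^ 2) :=
    fun t h0 h1 c => by rw [div_eq_mul_one_div, one_div_cos_sq (hcos t h0 h1).ne']
  set w := √((B - b) / b) with hw
  have hwpos : 0 < w := sqrt_pos.2 (div_pos (by linarith) hb)
  have hwsq : b * w ^ 2 = B - b := by
    rw [hw, sq_sqrt (div_nonneg (by linarith) hb.le)]
    field_simp
  set τ := arctan w with hτ
  have htτ : tan τ = w := tan_arctan w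
  have hτ0 : 0 ≤ τ := arctan_nonneg.2 hwpos.le
  have hτ2 : τ < π / 2 := arctan_lt_pi_div_two w
  have htθ0 : 0 ≤ tan θ := tan_nonneg_of_nonneg_of_le_pi_div_two hθ0 hθ.le
  have hτθ : τ ≤ θ := by
    by_contra! hlt
    have h := tan_lt_tan_of_nonneg_of_lt_pi_div_two hθ0 hτ2 hlt
    rw [htτ] at h
    rw [hsec θ hθ0 le_rfl] at hq
    nlinarith [mul_le_mul_of_nonneg_left (pow_le_pow_left₀ htθ0 h.le 2) hb.le]
  have hBpos : 0 < √B := sqrt_pos.2 (by linarith)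
  have hφ : ∀ α β : ℝ, 0 ≤ α → β < π / 2 → ContinuousOn
      (fun t => √|a / cos t ^ 2 - B| - √|b / cos t ^ 2 - B|) (Set.Icc α β) := fun α β h1 h2 =>
    (continuousOn_sqrt_abs_div_cos_sq_sub a B h1 h2).sub
      (continuousOn_sqrt_abs_div_cos_sq_sub b B h1 h2)
  have left := intervalIntegral.sub_le_integral_of_hasDeriv_right_of_le hτ0
    (g := fun t => (b - a) / (2 * √B) * tan t)
    (g' := fun t => (b - a) / (2 * √B) * (1 / cos t ^ 2))
    (φ := fun t => √|a / cos t ^ 2 - B| - √|b / cos t ^ 2 - B|)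
    (continuousOn_const.mul (continuousOn_tan_Icc le_rfl hτ2)) ?_
    (hφ 0 τ le_rfl hτ2).integrableOn_Icc ?_
  · have right := intervalIntegral.sub_le_integral_of_hasDeriv_right_of_le hτθ
      (g := fun t => -((b - a) / (b * w) * √(b * (1 + tan t ^ 2) - B)))
      (g' := fun t => -((b - a) / (b * w) *
        (b * (2 * tan t * (1 / cos t ^ 2)) / (2 * √(b * (1 + tan t ^ 2) - B)))))
      (φ := fun t => √|a / cos t ^ 2 - B| - √|b / cos t ^ 2 - B|)
      ?_ ?_ (hφ τ θ hτ0 hθ).integrableOn_Icc ?_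
    · rw [← intervalIntegral.integral_add_adjacent_intervals (b := τ)
        ((hφ 0 τ le_rfl hτ2).intervalIntegrable_of_Icc hτ0)
        ((hφ τ θ hτ0 hθ).intervalIntegrable_of_Icc hτθ)]
      have h0 : b * (1 + w ^ 2) - B = 0 := by linarith
      have hsE : √(b * (1 + tan θ ^ 2) - B) ≤ E := by
        rw [← hsec θ hθ0 le_rfl]
        exact (sqrt_le_sqrt hQ).trans_eq (sqrt_sq hE)
      simp only [tan_zero, htτ, h0, sqrt_zero] at left right
      have h1 : (b - a) / (b * w) * √(b * (1 + tan θ ^ 2) - B) ≤ (b - a) / (2 * √B) * w := by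
        refine (mul_le_mul_of_nonneg_left hsE
          (div_nonneg (by linarith) (by positivity))).trans ?_
        rw [div_mul_eq_mul_div, div_mul_eq_mul_div, div_le_div_iff₀ (by positivity) (by positivity)]
        have := mul_le_mul_of_nonneg_left (hEB.trans_eq hwsq.symm) (sub_nonneg.2 hab)
        linarith
      linarith
    · exact (continuousOn_const.mul (((continuousOn_const.mul (continuousOn_const.add
        ((continuousOn_tan_Icc hτ0 hθ).pow 2))).sub continuousOn_const).sqrt)).neg
    · intro t ht
      have ht0 : 0 ≤ t := hτ0.trans ht.1.le
      have hc := hcos t ht0 ht.2.le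
      have hwt : w < tan t := by
        rw [← htτ]
        exact tan_lt_tan_of_nonneg_of_lt_pi_div_two hτ0 (ht.2.trans hθ) ht.1
      have hpos : 0 < b * (1 + tan t ^ 2) - B := by
        nlinarith [mul_lt_mul_of_pos_left (pow_lt_pow_left₀ hwt hwpos.le two_ne_zero) hb]
      have h1 : HasDerivAt (fun t => b * (1 + tan t ^ 2) - B)
          (b * (2 * tan t * (1 / cos t ^ 2))) t := by
        have := ((((hasDerivAt_tan hc.ne').pow 2).const_add 1).const_mul b).sub_const B
        simpa using this
      exact ((h1.sqrt hpos.ne').const_mul _).neg.hasDerivWithinAt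
    · intro t ht
      have ht0 : 0 ≤ t := hτ0.trans ht.1.le
      have hc := hcos t ht0 ht.2.le
      have hwt : w < tan t := by
        rw [← htτ]
        exact tan_lt_tan_of_nonneg_of_lt_pi_div_two hτ0 (ht.2.trans hθ) ht.1
      have hpos : 0 < b * (1 + tan t ^ 2) - B := by
        nlinarith [mul_lt_mul_of_pos_left (pow_lt_pow_left₀ hwt hwpos.le two_ne_zero) hb]
      have h := neg_div_sqrt_le_sqrt_abs_sub_sqrt_abs
        (p := a / cos t ^ 2 - B) (q := b / cos t ^ 2 - B) (by gcongr)
        (by rwa [hsec t ht0 ht.2.le])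
      refine le_trans (neg_le_neg ?_) h
      rw [← hsec t ht0 ht.2.le] at hpos ⊢
      have hs := sqrt_pos.2 hpos
      generalize √(b / cos t ^ 2 - B) = R at hs
      have h2 : (b / cos t ^ 2 - B - (a / cos t ^ 2 - B)) / R = (b - a) / cos t ^ 2 / R := by ring
      have h3 : (b - a) / (b * w) * (b * (2 * tan t * (1 / cos t ^ 2)) / (2 * R)) =
          (b - a) / cos t ^ 2 / R * (tan t / w) := by
        field_simp
      rw [h2, h3]
      exact le_mul_of_one_le_right
        (div_nonneg (div_nonneg (by linarith) (by positivity)) hs.le)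
        ((one_le_div hwpos).2 hwt.le)
  · intro t ht
    exact ((hasDerivAt_tan (hcos t ht.1.le (ht.2.le.trans hτθ)).ne').const_mul _).hasDerivWithinAt
  · intro t ht
    have htθ := ht.2.le.trans hτθ
    have hc := hcos t ht.1.le htθ
    have hwt : tan t < w := by
      rw [← htτ]
      exact tan_lt_tan_of_nonneg_of_lt_pi_div_two ht.1.le hτ2 ht.2
    have ht0 : 0 ≤ tan t :=
      tan_nonneg_of_nonneg_of_le_pi_div_two ht.1.le (by linarith)
    have h := div_two_sqrt_le_sqrt_abs_sub_sqrt_abs (B := B)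
      (p := a / cos t ^ 2 - B) (q := b / cos t ^ 2 - B) (by gcongr) (by
        rw [hsec t ht.1.le htθ]
        nlinarith [mul_le_mul_of_nonneg_left (pow_le_pow_left₀ ht0 hwt.le 2) hb.le])
      (by linarith) (by
        have : 0 ≤ a / cos t ^ 2 := by positivity
        linarith)
    refine le_trans (le_of_eq ?_) h
    ring

lemma Slm_sub_Slm (ℓ : ℕ) (m n : ℤ) {θ : ℝ} (hθ0 : 0 ≤ θ) (hθ : θ < π / 2) :
    Slm ℓ m θ - Slm ℓ n θ = ∫ t in (0 : ℝ)..θ,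
      (√|((m : ℝ) ^ 2 - 1 / 4) / cos t ^ 2 - ((ℓ : ℝ) + 1 / 2) ^ 2| -
        √|((n : ℝ) ^ 2 - 1 / 4) / cos t ^ 2 - ((ℓ : ℝ) + 1 / 2) ^ 2|) := by
  have h : ∀ (k : ℤ) (t : ℝ),
      Qlm ℓ k t = ((k : ℝ) ^ 2 - 1 / 4) / cos t ^ 2 - ((ℓ : ℝ) + 1 / 2) ^ 2 := by
    intro k t
    unfold Qlm
    ring
  have hi : ∀ c : ℝ, IntervalIntegrable
      (fun t => √|c / cos t ^ 2 - ((ℓ : ℝ) + 1 / 2) ^ 2|) MeasureTheory.volume 0 θ := fun c =>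
    (continuousOn_sqrt_abs_div_cos_sq_sub c _ le_rfl hθ).intervalIntegrable_of_Icc hθ0
  simp only [Slm, h]
  exact (intervalIntegral.integral_sub (hi _) (hi _)).symm

theorem stmt_9 (r : ℕ → ℝ) (hrpos : ∀ ℓ, 0 < r ℓ)
    (hrinf : Tendsto r atTop atTop)
    (hr0 : Tendsto (fun ℓ : ℕ => r ℓ / (ℓ : ℝ)) atTop (nhds 0)) :
    ∃ C > (0:ℝ), ∀ η₁ : ℝ, 2 ≤ η₁ →
      ∃ L : ℕ, 1 ≤ L ∧ ∀ ℓ : ℕ, L ≤ ℓ → ∀ m : ℤ,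
        r ℓ ≤ (m : ℝ) → (m : ℝ) ≤ 2 * r ℓ →
        ∀ θ ∈ Set.Icc (0:ℝ) (π / 2 - η₁ * r ℓ / (ℓ : ℝ)),
          0 ≤ Slm ℓ (m - 1) θ - Slm ℓ m θ ∧ Slm ℓ (m - 1) θ - Slm ℓ m θ ≤ C / η₁ := by
  have hpi := pi_pos
  refine ⟨2 * π ^ 2, by positivity, fun η hη => ?_⟩
  obtain ⟨L, hL⟩ := eventually_atTop.1 ((hrinf.eventually_ge_atTop 2).and
    (hr0.eventually_le_const (by norm_num : (0 : ℝ) < 1 / 100)))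
  refine ⟨max L 1, le_max_right _ _, fun ℓ hℓ m hm1 hm2 θ hθ => ?_⟩
  obtain ⟨hr2, hrℓ⟩ := hL ℓ ((le_max_left _ _).trans hℓ)
  have hℓ1 : (1 : ℝ) ≤ ℓ := by exact_mod_cast (le_max_right _ _).trans hℓ
  have hℓpos : (0 : ℝ) < ℓ := by linarith
  have hrpos := hrpos ℓ
  set R := r ℓ with hR
  set v := η * R / (ℓ : ℝ) with hv
  have hvpos : 0 < v := by positivity
  have hθ2 : θ < π / 2 := by linarith [hθ.2]
  have hrℓ' : R ≤ ℓ / 100 := by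
    rw [div_le_iff₀ hℓpos] at hrℓ
    linarith
  have hv2 : v ≤ π / 2 := by linarith [hθ.1, hθ.2]
  have hcosv : sin v ≤ cos θ := by
    rw [← cos_pi_div_two_sub]
    exact cos_le_cos_of_nonneg_of_le_pi hθ.1 (by linarith) hθ.2
  set u := 2 * (R / (ℓ : ℝ)) with hu
  have hupos : 0 < u := by positivity
  have huv : u ≤ v := by
    rw [hu, hv, mul_div_assoc]
    gcongr
  have hu1 : u ≤ 1 / 50 := by linarith
  have huℓ : u * ℓ = 2 * R := by
    rw [hu]
    field_simp
  have hsinu : 99 / 100 * u ≤ sin u := by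
    have := sin_gt_sub_cube hupos
    have h2 : u ^ 2 ≤ (1 / 50) ^ 2 := by gcongr
    nlinarith [mul_le_mul_of_nonneg_left h2 hupos.le]
  have hcosu : 99 / 100 * u ≤ cos θ :=
    (hsinu.trans (sin_le_sin_of_le_of_le_pi_div_two (by linarith) hv2 huv)).trans hcosv
  have hcpos : 0 < cos θ := by linarith
  rw [Slm_sub_Slm ℓ _ _ hθ.1 hθ2]
  push_cast
  set B := ((ℓ : ℝ) + 1 / 2) ^ 2 with hB
  have hBs : √B = ℓ + 1 / 2 := sqrt_sq (by positivity)
  have hmℓ : (m : ℝ) ≤ ℓ / 50 := by linarith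
  have hm2' : (2 : ℝ) ≤ m := by linarith
  have ha : 0 < ((m : ℝ) - 1) ^ 2 - 1 / 4 := by nlinarith
  have hab : ((m : ℝ) - 1) ^ 2 - 1 / 4 ≤ (m : ℝ) ^ 2 - 1 / 4 := by nlinarith
  have hmsq : (m : ℝ) ^ 2 ≤ (ℓ / 50) ^ 2 := by gcongr
  have hℓsq : 0 < (ℓ : ℝ) ^ 2 := by positivity
  have hbB : (m : ℝ) ^ 2 - 1 / 4 ≤ B / 4 := by
    rw [hB]
    linarith
  have hBpos : 0 < B := by positivity
  constructor
  · refine integral_sqrt_abs_sub_nonneg (E := (ℓ + 1 / 2) / 4) ha hab (by linarith) hθ.1 hθ2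
      (by positivity) ?_ ?_
    · have h1 : (m : ℝ) ≤ cos θ / (99 / 100) * ℓ := by
        have : u * ℓ ≤ cos θ / (99 / 100) * ℓ := by
          gcongr
          rw [le_div_iff₀ (by norm_num)]
          linarith
        linarith
      have h2 : (m : ℝ) ^ 2 ≤ (cos θ / (99 / 100) * ℓ) ^ 2 := by gcongr
      have h3 : ((m : ℝ) ^ 2 - 1 / 4) / cos θ ^ 2 ≤ (ℓ / (99 / 100)) ^ 2 := by
        rw [div_le_iff₀ (by positivity)]
        calc (m : ℝ) ^ 2 - 1 / 4 ≤ (cos θ / (99 / 100) * ℓ) ^ 2 := by linarith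
          _ = _ := by ring
      rw [hB]
      linarith
    · rw [hBs]
      linarith
  · refine (integral_sqrt_abs_sub_le ha hab (by linarith) hθ.1 hθ2).trans ?_
    have hsq : (ℓ : ℝ) / 2 ≤ √(B - (((m : ℝ) - 1) ^ 2 - 1 / 4)) := by
      apply le_sqrt_of_sq_le
      rw [hB]
      linarith
    have hcv : 2 / π * v ≤ cos θ := (mul_le_sin hvpos.le hv2).trans hcosv
    have htan : tan θ ≤ π / (2 * v) := by
      rw [tan_eq_sin_div_cos, div_le_div_iff₀ hcpos (by positivity)]
      have h1 : 2 * v ≤ π * cos θ := by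
        have := mul_le_mul_of_nonneg_left hcv hpi.le
        have h2 : π * (2 / π * v) = 2 * v := by field_simp
        linarith
      linarith [mul_le_mul_of_nonneg_right (sin_le_one θ) (by linarith : 0 ≤ 2 * v)]
    have hba : ((m : ℝ) ^ 2 - 1 / 4) - (((m : ℝ) - 1) ^ 2 - 1 / 4) ≤ 4 * R := by linarith
    have htan0 : 0 ≤ tan θ := tan_nonneg_of_nonneg_of_le_pi_div_two hθ.1 hθ2.le
    calc _ ≤ 4 * R * (π / 2) * (π / (2 * v)) / (ℓ / 2) := by gcongr
      _ = 2 * π ^ 2 / η := by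
        rw [hv]
        field_simp
        ring
end

section
/- Let (r_ℓ)_{ℓ≥1} be a sequence of positive real numbers with r_ℓ → ∞ and r_ℓ/ℓ → 0 as ℓ → ∞, let η₁ > 2 and 0 < η₂ < √2. Then there exist C > 0 and L ≥ 1 such that for all integers ℓ ≥ L: (1) for all integers m with ℓ − 2r_ℓ ≤ m ≤ ℓ − r_ℓ and all θ with |θ| < η₂ (r_ℓ/ℓ)^{1/2}, one has 𝓔_{ℓ,m}(θ) ≤ C r_ℓ^{−1}; and (2) for all integers m with r_ℓ ≤ m ≤ 2r_ℓ and all θ with |θ| < π/2 − η₁ r_ℓ/ℓ, one has 𝓔_{ℓ,m}(θ) ≤ C r_ℓ^{−1}. -/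
open Real Filter

/-- The WKB error integral. -/
noncomputable def Elm (ℓ : ℕ) (m : ℤ) (θ : ℝ) : ℝ :=
  ∫ t in (0:ℝ)..|θ|,
    (1 / (8 * |Qlm ℓ m t| ^ ((3:ℝ) / 2))) *
      |deriv (deriv (Qlm ℓ m)) t - 5 * (deriv (Qlm ℓ m) t) ^ 2 / (4 * Qlm ℓ m t)|

theorem hasDerivAt_Qlm (ℓ : ℕ) (m : ℤ) {t : ℝ} (ht : cos t ≠ 0) :
    HasDerivAt (Qlm ℓ m) (2 * ((m : ℝ) ^ 2 - 1 / 4) * sin t / cos t ^ 3) t := by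
  have h := ((((hasDerivAt_cos t).pow 2).inv (pow_ne_zero 2 ht)).const_mul
    ((m : ℝ) ^ 2 - 1 / 4)).sub_const (1 / 4 + (ℓ : ℝ) * ((ℓ : ℝ) + 1))
  refine (h.congr_deriv ?_).congr_of_eventuallyEq (Eventually.of_forall fun x => ?_)
  · simp only [Pi.pow_apply]
    field_simp
    push_cast
    ring
  · simp only [Qlm, Pi.inv_apply, Pi.pow_apply]
    ring

theorem deriv_deriv_Qlm (ℓ : ℕ) (m : ℤ) {t : ℝ} (ht : cos t ≠ 0) :
    deriv (deriv (Qlm ℓ m)) t =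
      2 * ((m : ℝ) ^ 2 - 1 / 4) * (cos t ^ 2 + 3 * sin t ^ 2) / cos t ^ 4 := by
  have hev : deriv (Qlm ℓ m) =ᶠ[nhds t]
      fun x => 2 * ((m : ℝ) ^ 2 - 1 / 4) * sin x / cos x ^ 3 := by
    filter_upwards [continuous_cos.continuousAt.eventually_ne ht] with x hx
    exact (hasDerivAt_Qlm ℓ m hx).deriv
  rw [hev.deriv_eq]
  have h := ((hasDerivAt_sin t).const_mul (2 * ((m : ℝ) ^ 2 - 1 / 4))).div
    ((hasDerivAt_cos t).pow 3) (pow_ne_zero 3 ht)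
  refine (h.congr_deriv ?_).deriv
  simp only [Pi.pow_apply]
  field_simp
  ring

/-- Pointwise bound for the WKB error density where `Q ≤ -e²`. -/
theorem wkb_density_le (ℓ : ℕ) (m : ℤ) {t e : ℝ} (he : 0 < e) (ht : 0 < cos t)
    (hm : 0 ≤ (m : ℝ) ^ 2 - 1 / 4) (hQ : Qlm ℓ m t ≤ -e ^ 2) :
    (1 / (8 * |Qlm ℓ m t| ^ ((3:ℝ) / 2))) *
      |deriv (deriv (Qlm ℓ m)) t - 5 * (deriv (Qlm ℓ m) t) ^ 2 / (4 * Qlm ℓ m t)| ≤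
    1 / (8 * e ^ 3) * (6 * ((m : ℝ) ^ 2 - 1 / 4) / cos t ^ 4 +
      5 * ((m : ℝ) ^ 2 - 1 / 4) ^ 2 * sin t ^ 2 / (cos t ^ 6 * e ^ 2)) := by
  have he2 : 0 < e ^ 2 := by positivity
  have habs : e ^ 2 ≤ |Qlm ℓ m t| := by rw [abs_of_nonpos (by linarith)]; linarith
  have hpow : e ^ 3 ≤ |Qlm ℓ m t| ^ ((3:ℝ) / 2) := by
    calc e ^ 3 = (e ^ 2) ^ ((3:ℝ) / 2) := by
          rw [← Real.rpow_natCast e 2, ← Real.rpow_mul he.le, ← Real.rpow_natCast e 3]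
          norm_num
      _ ≤ _ := Real.rpow_le_rpow he2.le habs (by norm_num)
  rw [deriv_deriv_Qlm ℓ m ht.ne', (hasDerivAt_Qlm ℓ m ht.ne').deriv]
  refine mul_le_mul ?_ ?_ (abs_nonneg _) (by positivity)
  · exact one_div_le_one_div_of_le (by positivity) (by linarith)
  · set a := (m : ℝ) ^ 2 - 1 / 4
    refine (abs_sub _ _).trans (add_le_add ?_ ?_)
    · rw [abs_of_nonneg (by positivity)]
      have h1 := sin_sq_add_cos_sq t
      refine div_le_div_of_nonneg_right ?_ (by positivity)
      nlinarith [mul_nonneg hm (sq_nonneg (cos t))]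
    · rw [abs_div, abs_mul (4 : ℝ), abs_of_nonneg (by positivity : (0:ℝ) ≤ 5 * _ ^ 2),
        abs_of_pos (by norm_num : (0:ℝ) < 4)]
      calc 5 * (2 * a * sin t / cos t ^ 3) ^ 2 / (4 * |Qlm ℓ m t|)
          ≤ 5 * (2 * a * sin t / cos t ^ 3) ^ 2 / (4 * e ^ 2) := by gcongr
        _ = _ := by field_simp; ring

/-- Bound for the WKB error integral from a majorant with a known primitive. -/
theorem Elm_le_sub (ℓ : ℕ) (m : ℤ) (θ : ℝ) {g G : ℝ → ℝ}
    (hG : ∀ t ∈ Set.Icc 0 |θ|, HasDerivAt G (g t) t) (hg : ContinuousOn g (Set.Icc 0 |θ|))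
    (hle : ∀ t ∈ Set.Icc 0 |θ|, (1 / (8 * |Qlm ℓ m t| ^ ((3:ℝ) / 2))) *
      |deriv (deriv (Qlm ℓ m)) t - 5 * (deriv (Qlm ℓ m) t) ^ 2 / (4 * Qlm ℓ m t)| ≤ g t) :
    Elm ℓ m θ ≤ G |θ| - G 0 := by
  have h0 : (0:ℝ) ≤ |θ| := abs_nonneg θ
  rw [← Set.uIcc_of_le h0] at hG hg
  have hint := hg.intervalIntegrable (μ := MeasureTheory.volume)
  rw [← intervalIntegral.integral_eq_sub_of_hasDerivAt hG hint]
  refine (Real.le_norm_self _).trans (intervalIntegral.norm_integral_le_of_norm_le h0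
    (Eventually.of_forall fun t ht => ?_) hint)
  rw [Real.norm_of_nonneg (by positivity)]
  exact hle t (Set.Ioc_subset_Icc_self ht)

theorem Int.cast_sq_sub_quarter_nonneg {m : ℤ} (hm : (0:ℝ) < m) : 0 ≤ (m : ℝ) ^ 2 - 1 / 4 := by
  have h1 : (1:ℝ) ≤ m := by exact_mod_cast (by exact_mod_cast hm : (0:ℤ) < m)
  nlinarith

theorem Qlm_le_of_near_top {ℓ : ℕ} {m : ℤ} {s d η t : ℝ} (hℓ : 0 < (ℓ : ℝ))
    (hdη : 2 * d ^ 2 = 2 - η ^ 2) (hs4 : s ^ 2 < 1 / 4) (hsd : s ^ 2 < d ^ 2)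
    (hA2 : (m : ℝ) ^ 2 - 1 / 4 ≤ (ℓ - s ^ 2 * ℓ) ^ 2) (hcos : 0 < cos t)
    (hc2 : 1 - η ^ 2 * s ^ 2 ≤ cos t ^ 2) : Qlm ℓ m t ≤ -(d * ℓ * s) ^ 2 := by
  have hA4 : (m : ℝ) ^ 2 - 1 / 4 ≤ (ℓ ^ 2 - (d * ℓ * s) ^ 2) * cos t ^ 2 := by
    refine hA2.trans ?_
    have h1 : (1 - s ^ 2) ^ 2 ≤ (1 - d ^ 2 * s ^ 2) * (1 - η ^ 2 * s ^ 2) := by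
      have : 0 ≤ s ^ 2 * (d ^ 2 - s ^ 2) := by nlinarith
      nlinarith [mul_nonneg (sq_nonneg (d * s)) (sq_nonneg (η * s))]
    have h3 : d ^ 2 ≤ 1 := by nlinarith
    have h2 : (1 - d ^ 2 * s ^ 2) * (1 - η ^ 2 * s ^ 2) ≤ (1 - d ^ 2 * s ^ 2) * cos t ^ 2 := by
      refine mul_le_mul_of_nonneg_left (by linarith) ?_
      nlinarith [sq_nonneg s]
    have := mul_le_mul_of_nonneg_left (h1.trans h2) (sq_nonneg (ℓ : ℝ))
    linarith
  have := (div_le_iff₀ (by positivity : 0 < cos t ^ 2)).2 hA4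
  unfold Qlm
  nlinarith

/-- Estimate for `m` close to `ℓ`, with `r = s² ℓ`. -/
theorem Elm_le_of_near_top {ℓ : ℕ} {m : ℤ} {s d η θ : ℝ} (hℓ : 0 < (ℓ : ℝ)) (hs : 0 < s)
    (hd : 0 < d) (hη : 0 < η) (hdη : 2 * d ^ 2 = 2 - η ^ 2) (hs4 : s ^ 2 < 1 / 4)
    (hsd : s ^ 2 < d ^ 2) (hm1 : (ℓ : ℝ) - 2 * (s ^ 2 * ℓ) ≤ m) (hm2 : (m : ℝ) ≤ ℓ - s ^ 2 * ℓ)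
    (hθ : |θ| < η * s) :
    Elm ℓ m θ ≤ (24 + 80 / d ^ 2) * η / (8 * d ^ 3) / (s ^ 2 * ℓ) := by
  have hm0 : (0:ℝ) < m := by nlinarith
  have hA := Int.cast_sq_sub_quarter_nonneg hm0
  have hA2 : (m : ℝ) ^ 2 - 1 / 4 ≤ (ℓ - s ^ 2 * ℓ) ^ 2 := by nlinarith
  have hA3 : (m : ℝ) ^ 2 - 1 / 4 ≤ ℓ ^ 2 := by
    refine hA2.trans (pow_le_pow_left₀ (by nlinarith) ?_ 2)
    have : 0 < s ^ 2 * ℓ := by positivity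
    linarith
  obtain ⟨K, hK⟩ : ∃ K : ℝ, K = 1 / (8 * (d * ℓ * s) ^ 3) * ((24 + 80 / d ^ 2) * ℓ ^ 2) :=
    ⟨_, rfl⟩
  have key : Elm ℓ m θ ≤ K * |θ| - K * 0 := by
    refine Elm_le_sub ℓ m θ (g := fun _ => K) (G := fun t => K * t)
      (fun t _ => by simpa using (hasDerivAt_id t).const_mul K) continuousOn_const ?_
    intro t ht
    have ht2 : t ^ 2 ≤ η ^ 2 * s ^ 2 := by
      rw [← mul_pow]; exact pow_le_pow_left₀ ht.1 (ht.2.trans hθ.le) 2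
    have hη2 : η ^ 2 ≤ 2 := by nlinarith
    have ht2' : t ^ 2 ≤ 2 * s ^ 2 := by nlinarith
    have hsin : sin t ^ 2 ≤ t ^ 2 := by
      rw [sq_le_sq]; exact abs_sin_le_abs
    have hsc := sin_sq_add_cos_sq t
    have hc2 : 1 / 2 ≤ cos t ^ 2 := by linarith
    have hcos : 0 < cos t := by
      refine cos_pos_of_mem_Ioo ⟨by linarith [ht.1, pi_pos], ?_⟩
      nlinarith [pi_gt_three]
    have hQ := Qlm_le_of_near_top hℓ hdη hs4 hsd hA2 hcos (by linarith)
    refine (wkb_density_le ℓ m (by positivity) hcos hA hQ).trans ?_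
    rw [hK]
    refine mul_le_mul_of_nonneg_left ?_ (by positivity)
    generalize (m : ℝ) ^ 2 - 1 / 4 = a at *
    have hc4 : 1 / 4 ≤ cos t ^ 4 := by
      have := pow_le_pow_left₀ (by norm_num) hc2 2
      rw [← pow_mul] at this
      norm_num at this ⊢
      exact this
    have hc6 : 1 / 8 ≤ cos t ^ 6 := by
      have := pow_le_pow_left₀ (by norm_num) hc2 3
      rw [← pow_mul] at this
      norm_num at this ⊢
      exact this
    have e1 : 6 * a / cos t ^ 4 ≤ 24 * ℓ ^ 2 := by
      rw [div_le_iff₀ (by positivity)]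
      linarith [mul_le_mul_of_nonneg_left hc4 (sq_nonneg (ℓ : ℝ))]
    have e2 : 5 * a ^ 2 * sin t ^ 2 / (cos t ^ 6 * (d * ℓ * s) ^ 2) ≤ 80 / d ^ 2 * ℓ ^ 2 := by
      calc 5 * a ^ 2 * sin t ^ 2 / (cos t ^ 6 * (d * ℓ * s) ^ 2)
          ≤ 5 * ((ℓ : ℝ) ^ 2) ^ 2 * (2 * s ^ 2) / (1 / 8 * (d * ℓ * s) ^ 2) := by
            gcongr
            exact hsin.trans ht2'
        _ = _ := by field_simp; norm_num
    linarith
  refine key.trans ?_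
  calc K * |θ| - K * 0 ≤ K * (η * s) := by
        rw [mul_zero, sub_zero]; exact mul_le_mul_of_nonneg_left hθ.le (by rw [hK]; positivity)
    _ = _ := by rw [hK]; field_simp

/-- Estimate for small `m`, away from the poles. -/
theorem Elm_le_of_small {ℓ : ℕ} {m : ℤ} {r d κ θ : ℝ} (hℓ : 0 < (ℓ : ℝ)) (hr : 0 < r)
    (hd : 0 < d) (hκ : 2 < κ) (hdκ : d ^ 2 = 1 - 4 / κ ^ 2) (hm1 : r ≤ m) (hm2 : (m : ℝ) ≤ 2 * r)
    (hθ : |θ| ≤ π / 2) (hcosθ : κ * (r / ℓ) ≤ cos |θ|) :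
    Elm ℓ m θ ≤ (24 + 20 / d ^ 2) / (6 * d ^ 3) / r := by
  have hm0 : (0:ℝ) < m := hr.trans_le hm1
  have hA := Int.cast_sq_sub_quarter_nonneg hm0
  have hA2 : (m : ℝ) ^ 2 - 1 / 4 ≤ 4 * r ^ 2 := by nlinarith
  have hκ0 : 0 < κ := by linarith
  have hlow : 0 < κ * (r / ℓ) := by positivity
  have hcos : ∀ t ∈ Set.Icc 0 |θ|, κ * (r / ℓ) ≤ cos t := fun t ht =>
    hcosθ.trans (cos_le_cos_of_nonneg_of_le_pi ht.1 (by linarith [pi_pos]) ht.2)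
  obtain ⟨K, hK⟩ : ∃ K : ℝ, K = 1 / (8 * (d * ℓ) ^ 3) * ((24 + 20 / d ^ 2) * r ^ 2) :=
    ⟨_, rfl⟩
  have key : Elm ℓ m θ ≤ K * (tan |θ| + tan |θ| ^ 3 / 3) - K * (tan 0 + tan 0 ^ 3 / 3) := by
    refine Elm_le_sub ℓ m θ (g := fun t => K * (1 / cos t ^ 4))
      (G := fun t => K * (tan t + tan t ^ 3 / 3)) (fun t ht => ?_) ?_ ?_
    · have hc : cos t ≠ 0 := (hlow.trans_le (hcos t ht)).ne'
      have h := ((hasDerivAt_tan hc).add (((hasDerivAt_tan hc).pow 3).div_const 3)).const_mul K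
      refine h.congr_deriv ?_
      rw [tan_eq_sin_div_cos, show 3 - 1 = 2 from rfl]
      have := sin_sq_add_cos_sq t
      push_cast
      field_simp
      linear_combination K * this
    · refine continuousOn_const.mul (continuousOn_const.div (by fun_prop) fun t ht => ?_)
      exact pow_ne_zero 4 (hlow.trans_le (hcos t ht)).ne'
    intro t ht
    have hc := hlow.trans_le (hcos t ht)
    have hAc : ((m : ℝ) ^ 2 - 1 / 4) / cos t ^ 2 ≤ 4 / κ ^ 2 * ℓ ^ 2 := by
      calc ((m : ℝ) ^ 2 - 1 / 4) / cos t ^ 2 ≤ 4 * r ^ 2 / (κ * (r / ℓ)) ^ 2 := by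
            gcongr
            exact hcos t ht
        _ = _ := by field_simp
    have hQ : Qlm ℓ m t ≤ -(d * ℓ) ^ 2 := by
      unfold Qlm
      rw [mul_pow, hdκ]
      nlinarith
    refine (wkb_density_le ℓ m (by positivity) hc hA hQ).trans ?_
    rw [hK, mul_assoc (1 / (8 * (d * (ℓ : ℝ)) ^ 3))]
    refine mul_le_mul_of_nonneg_left ?_ (by positivity)
    generalize (m : ℝ) ^ 2 - 1 / 4 = a at *
    have h4 : 4 / κ ^ 2 ≤ 1 := by nlinarith
    have hAc' : a / cos t ^ 2 ≤ ℓ ^ 2 := hAc.trans (by nlinarith)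
    have hs : sin t ^ 2 ≤ 1 := sin_sq_le_one t
    have e1 : 6 * a / cos t ^ 4 ≤ 24 * r ^ 2 / cos t ^ 4 := by
      refine div_le_div_of_nonneg_right ?_ (by positivity)
      linarith
    have e2 : 5 * a ^ 2 * sin t ^ 2 / (cos t ^ 6 * (d * ℓ) ^ 2) ≤
        20 / d ^ 2 * r ^ 2 / cos t ^ 4 := by
      calc 5 * a ^ 2 * sin t ^ 2 / (cos t ^ 6 * (d * ℓ) ^ 2)
          = 5 * a / (cos t ^ 4 * (d * ℓ) ^ 2) * (a / cos t ^ 2) * sin t ^ 2 := by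
            field_simp
        _ ≤ 5 * (4 * r ^ 2) / (cos t ^ 4 * (d * ℓ) ^ 2) * ℓ ^ 2 * 1 := by gcongr
        _ = _ := by field_simp; norm_num
    calc _ ≤ 24 * r ^ 2 / cos t ^ 4 + 20 / d ^ 2 * r ^ 2 / cos t ^ 4 := add_le_add e1 e2
      _ = _ := by ring
  have hcb : 0 < cos |θ| := hlow.trans_le hcosθ
  have htan : tan |θ| ≤ 1 / cos |θ| := by
    rw [tan_eq_sin_div_cos]
    gcongr
    exact sin_le_one _
  have htan0 : 0 ≤ tan |θ| := tan_nonneg_of_nonneg_of_le_pi_div_two (abs_nonneg θ) hθ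
  have h1 : 1 ≤ 1 / cos |θ| := by
    rw [le_div_iff₀ hcb, one_mul]; exact cos_le_one |θ|
  have hx : 1 / cos |θ| ≤ ℓ / r := by
    calc 1 / cos |θ| ≤ 1 / (κ * (r / ℓ)) := by gcongr
      _ ≤ 1 / (1 * (r / ℓ)) := by gcongr; linarith
      _ = ℓ / r := by field_simp
  have hK0 : 0 ≤ K := by rw [hK]; positivity
  have hT : tan |θ| + tan |θ| ^ 3 / 3 ≤ 4 / 3 * (ℓ / r) ^ 3 := by
    have h2 : tan |θ| ≤ (1 / cos |θ|) ^ 3 := htan.trans (le_self_pow₀ h1 (by norm_num))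
    have h3 : tan |θ| ^ 3 ≤ (1 / cos |θ|) ^ 3 := pow_le_pow_left₀ htan0 htan 3
    have h4 : (1 / cos |θ|) ^ 3 ≤ (ℓ / r) ^ 3 := pow_le_pow_left₀ (by positivity) hx 3
    linarith
  calc Elm ℓ m θ ≤ K * (tan |θ| + tan |θ| ^ 3 / 3) := by simpa using key
    _ ≤ K * (4 / 3 * (ℓ / r) ^ 3) := mul_le_mul_of_nonneg_left hT hK0
    _ = _ := by rw [hK]; field_simp; norm_num

/-- Accuracy of the WKB approximation. -/
theorem stmt_11 (r : ℕ → ℝ) (hrpos : ∀ ℓ, 0 < r ℓ)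
    (hrinf : Tendsto r atTop atTop)
    (hr0 : Tendsto (fun ℓ : ℕ => r ℓ / (ℓ : ℝ)) atTop (nhds 0))
    (η₁ η₂ : ℝ) (hη₁ : 2 < η₁) (hη₂0 : 0 < η₂) (hη₂ : η₂ < Real.sqrt 2) :
    ∃ C > (0:ℝ), ∃ L : ℕ, 1 ≤ L ∧ ∀ ℓ : ℕ, L ≤ ℓ →
      (∀ m : ℤ, (ℓ : ℝ) - 2 * r ℓ ≤ (m : ℝ) → (m : ℝ) ≤ (ℓ : ℝ) - r ℓ →
        ∀ θ : ℝ, |θ| < η₂ * Real.sqrt (r ℓ / (ℓ : ℝ)) → Elm ℓ m θ ≤ C / r ℓ) ∧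
      (∀ m : ℤ, r ℓ ≤ (m : ℝ) → (m : ℝ) ≤ 2 * r ℓ →
        ∀ θ : ℝ, |θ| < π / 2 - η₁ * r ℓ / (ℓ : ℝ) → Elm ℓ m θ ≤ C / r ℓ) := by
  have hd₂ : 0 < (2 - η₂ ^ 2) / 2 := by
    have := (Real.lt_sqrt hη₂0.le).1 hη₂
    linarith
  obtain ⟨κ, hκ, hκη⟩ := exists_between hη₁
  have hd₁ : 0 < 1 - 4 / κ ^ 2 := by
    rw [sub_pos, div_lt_one (by positivity)]
    nlinarith
  obtain ⟨d₁, hd₁0, hd₁sq⟩ : ∃ d : ℝ, 0 < d ∧ d ^ 2 = 1 - 4 / κ ^ 2 :=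
    ⟨√_, Real.sqrt_pos.2 hd₁, Real.sq_sqrt hd₁.le⟩
  obtain ⟨d₂, hd₂0, hd₂sq⟩ : ∃ d : ℝ, 0 < d ∧ d ^ 2 = (2 - η₂ ^ 2) / 2 :=
    ⟨√_, Real.sqrt_pos.2 hd₂, Real.sq_sqrt hd₂.le⟩
  have hlim : Tendsto (fun ℓ : ℕ => η₁ * (r ℓ / ℓ)) atTop (nhds 0) := by
    simpa using hr0.const_mul η₁
  have hlim' : Tendsto (fun ℓ : ℕ => η₁ * (1 - (η₁ * (r ℓ / ℓ)) ^ 2 / 6)) atTop (nhds η₁) := by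
    simpa using (((hlim.pow 2).div_const 6).const_sub 1).const_mul η₁
  have hev : ∀ᶠ ℓ : ℕ in atTop, r ℓ / ℓ < 1 / 4 ∧ r ℓ / ℓ < d₂ ^ 2 ∧
      κ < η₁ * (1 - (η₁ * (r ℓ / ℓ)) ^ 2 / 6) := by
    filter_upwards [hr0.eventually_lt_const (by norm_num : (0:ℝ) < 1 / 4),
      hr0.eventually_lt_const (by positivity : (0:ℝ) < d₂ ^ 2), hlim'.eventually_const_lt hκη] with ℓ h1 h2 h3
    exact ⟨h1, h2, h3⟩
  obtain ⟨L, hL⟩ := eventually_atTop.1 hev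
  set C₁ := (24 + 80 / d₂ ^ 2) * η₂ / (8 * d₂ ^ 3)
  set C₂ := (24 + 20 / d₁ ^ 2) / (6 * d₁ ^ 3)
  have hC₁ : 0 < C₁ := by positivity
  have hC₂ : 0 < C₂ := by positivity
  refine ⟨C₁ + C₂, by positivity, max 1 L, le_max_left _ _, fun ℓ hℓ => ?_⟩
  have hℓ0 : (0:ℝ) < ℓ := by exact_mod_cast (le_max_left 1 L).trans hℓ
  obtain ⟨h1, h2, h3⟩ := hL ℓ ((le_max_right 1 L).trans hℓ)
  have hr := hrpos ℓ
  have hρ : 0 < r ℓ / ℓ := by positivity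
  refine ⟨fun m hm1 hm2 θ hθ => ?_, fun m hm1 hm2 θ hθ => ?_⟩
  · have hs : √(r ℓ / ℓ) ^ 2 = r ℓ / ℓ := Real.sq_sqrt hρ.le
    have hsr : √(r ℓ / ℓ) ^ 2 * ℓ = r ℓ := by rw [hs]; field_simp
    have h := Elm_le_of_near_top (m := m) hℓ0 (Real.sqrt_pos.2 hρ) hd₂0 hη₂0 (by linarith)
      (by rwa [hs]) (by rwa [hs]) (by rwa [hsr]) (by rwa [hsr]) hθ
    rw [hsr] at h
    refine h.trans ?_
    gcongr
    linarith
  · rw [mul_div_assoc] at hθ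
    have hy : 0 < η₁ * (r ℓ / ℓ) := by positivity
    have hcos : κ * (r ℓ / ℓ) ≤ cos |θ| := by
      calc κ * (r ℓ / ℓ) ≤ η₁ * (1 - (η₁ * (r ℓ / ℓ)) ^ 2 / 6) * (r ℓ / ℓ) := by gcongr
        _ = η₁ * (r ℓ / ℓ) - (η₁ * (r ℓ / ℓ)) ^ 3 / 6 := by ring
        _ ≤ sin (η₁ * (r ℓ / ℓ)) := (sin_gt_sub_cube hy).le
        _ = cos (π / 2 - η₁ * (r ℓ / ℓ)) := (cos_pi_div_two_sub _).symm
        _ ≤ cos |θ| := cos_le_cos_of_nonneg_of_le_pi (abs_nonneg θ)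
            (by linarith [pi_pos]) hθ.le
    refine (Elm_le_of_small hℓ0 hr hd₁0 hκ hd₁sq hm1 hm2 (by linarith) hcos).trans ?_
    gcongr
    linarith
end

section
/- Let (r_ℓ)_{ℓ≥1} be a sequence of positive real numbers with r_ℓ → ∞ and r_ℓ/ℓ → 0 as ℓ → ∞, and let A ≥ 1. Then there exist η₁ > 0, η₂ > 0, c > 0 and L ≥ 1 with the following property. Let ℓ ≥ L be an integer, let M be either the set of integers m with ℓ − 2r_ℓ < m ≤ ℓ − r_ℓ or the set of integers m with r_ℓ ≤ m < 2r_ℓ, and let I denote respectively the interval (−η₂(r_ℓ/ℓ)^{1/2}, η₂(r_ℓ/ℓ)^{1/2}) or (−π/2 + η₁ r_ℓ/ℓ, π/2 − η₁ r_ℓ/ℓ). Then for every family of complex numbers (c_m)_{m∈M} with A^{−1} ℓ ≤ |c_m|² ≤ A ℓ for all m ∈ M, and for every θ ∈ I, one has ∑_{m∈M} |c_m y_{ℓ,m}(θ)|² ≥ c ∑_{m∈M} |c_m|² |Q_{ℓ,m}(θ)|^{−1/2}. -/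
open Real Filter

noncomputable def ylm (ℓ : ℕ) (m : ℤ) (θ : ℝ) : ℝ :=
  if Even ((ℓ : ℤ) + m) then Real.cos (Slm ℓ m θ) / |Qlm ℓ m θ| ^ ((1:ℝ) / 4)
  else Real.sin (Slm ℓ m θ) / |Qlm ℓ m θ| ^ ((1:ℝ) / 4)

theorem card_Ico_div_eight_le_sum {f : ℤ → ℝ} (hf : ∀ m, 0 ≤ f m) {p q : ℤ} (hpq : p + 2 ≤ q)
    (h : ∀ m, p ≤ m → m + 1 < q → 1 / 2 ≤ f m + f (m + 1)) :
    ((Finset.Ico p q).card : ℝ) / 8 ≤ ∑ m ∈ Finset.Ico p q, f m := by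
  have key : ∀ q, p + 1 ≤ q → (∀ m, p ≤ m → m + 1 < q → 1 / 2 ≤ f m + f (m + 1)) →
      ((q : ℝ) - p - 1) / 2 + f p + f (q - 1) ≤ 2 * ∑ m ∈ Finset.Ico p q, f m := by
    intro q hq
    induction q, hq using Int.leInduction with
    | base =>
      intro _
      rw [← Finset.insert_Ico_right_eq_Ico_add_one le_rfl]
      simp
      linarith
    | succ q hq ih =>
      intro hm
      have h1 := ih fun m hpm hmq => hm m hpm (by omega)
      have h2 := hm (q - 1) (by omega) (by omega)
      rw [← Finset.insert_Ico_right_eq_Ico_add_one (by omega),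
        Finset.sum_insert Finset.right_notMem_Ico]
      rw [sub_add_cancel] at h2
      rw [add_sub_cancel_right]
      push_cast
      linarith
  have h1 := key q (by omega) h
  have h2 : ((Finset.Ico p q).card : ℝ) = q - p := by
    rw [Int.card_Ico]
    exact_mod_cast Int.toNat_of_nonneg (by omega)
  have h3 : (p : ℝ) + 2 ≤ q := by exact_mod_cast hpq
  have h4 := hf p
  have h5 := hf (q - 1)
  rw [h2]
  linarith

theorem half_le_cos_sq_add_sin_sq {x y : ℝ} (h : |x - y| ≤ 1 / 4) :
    1 / 2 ≤ cos x ^ 2 + sin y ^ 2 := by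
  have h1 := (abs_sin_sub_sin_le x y).trans h
  have h2 := sin_sq_add_cos_sq x
  have h3 := abs_le.1 h1
  have h4 := abs_le.1 (abs_sin_le_one x)
  have h5 := abs_le.1 (abs_sin_le_one y)
  have h6 : |(sin x - sin y) * (sin x + sin y)| ≤ 1 / 4 * 2 := by
    rw [abs_mul]
    exact mul_le_mul h1 (abs_le.2 ⟨by linarith, by linarith⟩) (abs_nonneg _) (by norm_num)
  nlinarith [(abs_le.1 h6).2]

theorem Qlm_eq_tan (ℓ : ℕ) (m : ℤ) {θ : ℝ} (hθ : cos θ ≠ 0) :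
    Qlm ℓ m θ = (m : ℝ) ^ 2 + ((m : ℝ) ^ 2 - 1 / 4) * tan θ ^ 2 - ((ℓ : ℝ) + 1 / 2) ^ 2 - 1 / 4 := by
  have h : sin θ ^ 2 = 1 - cos θ ^ 2 := sin_sq θ
  rw [Qlm, tan_eq_sin_div_cos, div_pow, h]
  field_simp
  ring

theorem Qlm_le_of_abs_le (ℓ : ℕ) {m : ℤ} (hm : 1 ≤ m) {t θ : ℝ} (hθ : |θ| < π / 2)
    (ht : |t| ≤ |θ|) : Qlm ℓ m t ≤ Qlm ℓ m θ := by
  have h0 : 0 < cos θ := cos_pos_of_mem_Ioo (abs_lt.1 hθ)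
  have h1 : cos θ ≤ cos t := by
    rw [← cos_abs θ, ← cos_abs t]
    exact cos_le_cos_of_nonneg_of_le_pi (abs_nonneg _) (by linarith [pi_pos]) ht
  have h2 : (1 : ℝ) ≤ m := by exact_mod_cast hm
  have h3 : (0 : ℝ) ≤ (m : ℝ) ^ 2 - 1 / 4 := by nlinarith
  unfold Qlm
  gcongr

theorem continuousOn_sqrt_abs_Qlm (ℓ : ℕ) (m : ℤ) {s : Set ℝ} (hs : ∀ t ∈ s, cos t ≠ 0) :
    ContinuousOn (fun t => √|Qlm ℓ m t|) s := by
  unfold Qlm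
  have : ContinuousOn (fun t : ℝ => ((m : ℝ) ^ 2 - 1 / 4) / cos t ^ 2) s :=
    continuousOn_const.div (by fun_prop) fun t ht => pow_ne_zero 2 (hs t ht)
  fun_prop

theorem abs_le_of_mem_uIcc_zero {t θ : ℝ} (ht : t ∈ Set.uIcc 0 θ) : |t| ≤ |θ| := by
  simpa using Set.abs_sub_left_of_mem_uIcc ht

theorem abs_Slm_sub_Slm_add_one_le (ℓ : ℕ) {m : ℤ} (hm : 1 ≤ m) {θ K : ℝ} (hθ : |θ| < π / 2)
    (hK : 0 < K) (h₁ : K ^ 2 ≤ -Qlm ℓ m θ) (h₂ : K ^ 2 ≤ -Qlm ℓ (m + 1) θ) :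
    |Slm ℓ m θ - Slm ℓ (m + 1) θ| ≤ (2 * m + 1) / (2 * K) * |tan θ| := by
  have hm' : (1 : ℝ) ≤ m := by exact_mod_cast hm
  have habs : ∀ t ∈ Set.uIcc 0 θ, |t| ≤ |θ| := fun t ht => abs_le_of_mem_uIcc_zero ht
  have hcos : ∀ t ∈ Set.uIcc 0 θ, 0 < cos t := fun t ht =>
    cos_pos_of_mem_Ioo (abs_lt.1 ((habs t ht).trans_lt hθ))
  have hint : ∀ n : ℤ, IntervalIntegrable (fun t => √|Qlm ℓ n t|) MeasureTheory.volume 0 θ :=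
    fun n => (continuousOn_sqrt_abs_Qlm ℓ n fun t ht => (hcos t ht).ne').intervalIntegrable
  have hcont : ContinuousOn (fun t => 1 / cos t ^ 2) (Set.uIcc 0 θ) :=
    continuousOn_const.div (by fun_prop) fun t ht => pow_ne_zero 2 (hcos t ht).ne'
  have htan : ∫ t in (0 : ℝ)..θ, 1 / cos t ^ 2 = tan θ := by
    rw [intervalIntegral.integral_eq_sub_of_hasDerivAt
      (fun t ht => hasDerivAt_tan (hcos t ht).ne') hcont.intervalIntegrable]
    simp
  have hbound : ∀ t ∈ Set.uIcc 0 θ,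
      ‖√|Qlm ℓ m t| - √|Qlm ℓ (m + 1) t|‖ ≤ (2 * m + 1) / (2 * K) * (1 / cos t ^ 2) := by
    intro t ht
    have hroot : ∀ n : ℤ, 1 ≤ n → K ^ 2 ≤ -Qlm ℓ n θ →
        K ≤ √|Qlm ℓ n t| ∧ √|Qlm ℓ n t| ^ 2 = -Qlm ℓ n t := by
      intro n hn h
      have h' : K ^ 2 ≤ -Qlm ℓ n t := by linarith [Qlm_le_of_abs_le ℓ hn hθ (habs t ht)]
      have hneg : |Qlm ℓ n t| = -Qlm ℓ n t := abs_of_nonpos (by nlinarith)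
      exact ⟨le_sqrt_of_sq_le (hneg ▸ h'), by rw [sq_sqrt (abs_nonneg _), hneg]⟩
    obtain ⟨ha, ha2⟩ := hroot m hm h₁
    obtain ⟨hb, hb2⟩ := hroot (m + 1) (by omega) h₂
    have hprod : (√|Qlm ℓ m t| - √|Qlm ℓ (m + 1) t|) * (√|Qlm ℓ m t| + √|Qlm ℓ (m + 1) t|)
        = (2 * m + 1) * (1 / cos t ^ 2) := by
      have : Qlm ℓ (m + 1) t - Qlm ℓ m t = (2 * m + 1) * (1 / cos t ^ 2) := by
        unfold Qlm
        push_cast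
        ring
      linear_combination ha2 - hb2 + this
    have hpos : 0 ≤ (2 * m + 1) * (1 / cos t ^ 2) := by positivity
    have hdiff : 0 ≤ √|Qlm ℓ m t| - √|Qlm ℓ (m + 1) t| := by
      by_contra! hlt
      nlinarith
    rw [norm_eq_abs, abs_of_nonneg hdiff, div_mul_eq_mul_div, le_div_iff₀ (by positivity), ← hprod]
    exact mul_le_mul_of_nonneg_left (by linarith) hdiff
  have hg : IntervalIntegrable (fun t => (2 * (m : ℝ) + 1) / (2 * K) * (1 / cos t ^ 2))
      MeasureTheory.volume 0 θ := hcont.intervalIntegrable.const_mul _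
  have := intervalIntegral.norm_integral_le_abs_of_norm_le
    (f := fun t => √|Qlm ℓ m t| - √|Qlm ℓ (m + 1) t|)
    ((MeasureTheory.ae_restrict_mem measurableSet_uIoc).mono fun t ht =>
      hbound t (Set.uIoc_subset_uIcc ht)) hg
  rw [intervalIntegral.integral_sub (hint _) (hint _), intervalIntegral.integral_const_mul, htan,
    abs_mul, abs_of_nonneg (by positivity), norm_eq_abs] at this
  exact this

theorem ylm_sq (ℓ : ℕ) (m : ℤ) (θ : ℝ) :
    ylm ℓ m θ ^ 2 =
      (if Even ((ℓ : ℤ) + m) then cos (Slm ℓ m θ) ^ 2 else sin (Slm ℓ m θ) ^ 2) *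
        |Qlm ℓ m θ| ^ (-(1 : ℝ) / 2) := by
  have h : (|Qlm ℓ m θ| ^ (-(1 : ℝ) / 2)) = ((|Qlm ℓ m θ| ^ ((1 : ℝ) / 4)) ^ 2)⁻¹ := by
    rw [← rpow_natCast, ← rpow_mul (abs_nonneg _), ← rpow_neg (abs_nonneg _)]
    norm_num
  unfold ylm
  split_ifs <;> rw [h, div_pow, div_eq_mul_inv]

theorem sum_sq_norm_mul_ylm_ge {ℓ : ℕ} {p q : ℤ} (hp : 1 ≤ p) (hpq : p + 2 ≤ q) {A B K θ : ℝ}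
    (hA : 0 < A) (hB : 0 < B) (hK : 0 < K) (hθ : |θ| < π / 2)
    (hQ : ∀ m ∈ Finset.Ico p q, K ^ 2 ≤ -Qlm ℓ m θ ∧ -Qlm ℓ m θ ≤ (B * K) ^ 2)
    (htan : ∀ m ∈ Finset.Ico p q, (2 * (m : ℝ) + 1) * |tan θ| ≤ K / 2) {cm : ℤ → ℂ}
    (hcm : ∀ m ∈ Finset.Ico p q, A⁻¹ * (ℓ : ℝ) ≤ ‖cm m‖ ^ 2 ∧ ‖cm m‖ ^ 2 ≤ A * (ℓ : ℝ)) :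
    1 / (8 * A ^ 2 * B) * ∑ m ∈ Finset.Ico p q, ‖cm m‖ ^ 2 * |Qlm ℓ m θ| ^ (-(1 : ℝ) / 2) ≤
      ∑ m ∈ Finset.Ico p q, ‖cm m * ((ylm ℓ m θ : ℝ) : ℂ)‖ ^ 2 := by
  set f : ℤ → ℝ := fun m =>
    if Even ((ℓ : ℤ) + m) then cos (Slm ℓ m θ) ^ 2 else sin (Slm ℓ m θ) ^ 2 with hf_def
  have hf : ∀ m, 0 ≤ f m := fun m => by
    simp only [hf_def]
    split_ifs <;> positivity
  have hpair : ∀ m, p ≤ m → m + 1 < q → 1 / 2 ≤ f m + f (m + 1) := by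
    intro m hpm hmq
    have hmem : m ∈ Finset.Ico p q := Finset.mem_Ico.2 ⟨hpm, by omega⟩
    have hmem' : m + 1 ∈ Finset.Ico p q := Finset.mem_Ico.2 ⟨by omega, hmq⟩
    have hS : |Slm ℓ m θ - Slm ℓ (m + 1) θ| ≤ 1 / 4 := by
      refine (abs_Slm_sub_Slm_add_one_le ℓ (by omega) hθ hK (hQ m hmem).1 (hQ _ hmem').1).trans ?_
      rw [div_mul_eq_mul_div, div_le_iff₀ (by positivity)]
      linarith [htan m hmem]
    have hparity : Even ((ℓ : ℤ) + (m + 1)) ↔ ¬ Even ((ℓ : ℤ) + m) := by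
      rw [← add_assoc, Int.even_add_one]
    simp only [hf_def, hparity]
    by_cases he : Even ((ℓ : ℤ) + m)
    · simpa [he] using half_le_cos_sq_add_sin_sq hS
    · rw [abs_sub_comm] at hS
      simpa [he, add_comm (cos _ ^ 2)] using half_le_cos_sq_add_sin_sq hS
  have hroot : ∀ m ∈ Finset.Ico p q, (B * K)⁻¹ ≤ |Qlm ℓ m θ| ^ (-(1 : ℝ) / 2) ∧
      |Qlm ℓ m θ| ^ (-(1 : ℝ) / 2) ≤ K⁻¹ := by
    intro m hm
    obtain ⟨h₁, h₂⟩ := hQ m hm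
    have hneg : |Qlm ℓ m θ| = -Qlm ℓ m θ := abs_of_nonpos (by nlinarith)
    rw [neg_div, rpow_neg (abs_nonneg _), ← sqrt_eq_rpow]
    have hKs : K ≤ √|Qlm ℓ m θ| := le_sqrt_of_sq_le (hneg ▸ h₁)
    have hsB : √|Qlm ℓ m θ| ≤ B * K := (sqrt_le_left (by positivity)).2 (hneg ▸ h₂)
    exact ⟨inv_anti₀ (hK.trans_le hKs) hsB, inv_anti₀ hK hKs⟩
  have hupper : ∑ m ∈ Finset.Ico p q, ‖cm m‖ ^ 2 * |Qlm ℓ m θ| ^ (-(1 : ℝ) / 2) ≤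
      (Finset.Ico p q).card * (A * ℓ * K⁻¹) := by
    rw [← nsmul_eq_mul]
    refine Finset.sum_le_card_nsmul _ _ _ fun m hm => ?_
    exact mul_le_mul (hcm m hm).2 (hroot m hm).2 (by positivity) (by positivity)
  have hlower : (A⁻¹ * ℓ * (B * K)⁻¹) * ∑ m ∈ Finset.Ico p q, f m ≤
      ∑ m ∈ Finset.Ico p q, ‖cm m * ((ylm ℓ m θ : ℝ) : ℂ)‖ ^ 2 := by
    rw [Finset.mul_sum]
    refine Finset.sum_le_sum fun m hm => ?_
    have : ‖cm m * ((ylm ℓ m θ : ℝ) : ℂ)‖ ^ 2 =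
        ‖cm m‖ ^ 2 * |Qlm ℓ m θ| ^ (-(1 : ℝ) / 2) * f m := by
      rw [norm_mul, mul_pow, Complex.norm_real, norm_eq_abs, sq_abs, ylm_sq]
      ring
    rw [this]
    exact mul_le_mul_of_nonneg_right
      (mul_le_mul (hcm m hm).1 (hroot m hm).1 (by positivity) (by positivity)) (hf m)
  calc _ ≤ 1 / (8 * A ^ 2 * B) * ((Finset.Ico p q).card * (A * ℓ * K⁻¹)) := by gcongr
    _ = (A⁻¹ * ℓ * (B * K)⁻¹) * ((Finset.Ico p q).card / 8) := by field_simp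
    _ ≤ (A⁻¹ * ℓ * (B * K)⁻¹) * ∑ m ∈ Finset.Ico p q, f m := by
      gcongr
      exact card_Ico_div_eight_le_sum hf hpq hpair
    _ ≤ _ := hlower

theorem Qlm_bounds_near_equator {ℓ : ℕ} {m : ℤ} {ρ θ : ℝ} (hρ : 1 ≤ ρ) (hρℓ : 16 * ρ ≤ ℓ)
    (hm₁ : (ℓ : ℝ) - 2 * ρ < m) (hm₂ : (m : ℝ) ≤ ℓ - ρ) (hθ : |θ| < 1 / 12 * √(ρ / ℓ)) :
    |θ| < π / 2 ∧ √(ℓ * ρ) ^ 2 ≤ -Qlm ℓ m θ ∧ -Qlm ℓ m θ ≤ (4 * √(ℓ * ρ)) ^ 2 ∧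
      (2 * (m : ℝ) + 1) * |tan θ| ≤ √(ℓ * ρ) / 2 := by
  have hℓ : (0 : ℝ) < ℓ := by linarith
  set s := √(ρ / ℓ) with hs
  have hs0 : 0 ≤ s := sqrt_nonneg _
  have hs2 : s ^ 2 = ρ / ℓ := sq_sqrt (by positivity)
  have hsK : √(ℓ * ρ) = ℓ * s := by
    rw [sqrt_eq_iff_mul_self_eq (by positivity) (by positivity)]
    have : ℓ * s * (ℓ * s) = (ℓ : ℝ) ^ 2 * s ^ 2 := by ring
    rw [this, hs2]
    field_simp
  have hsℓ : (ℓ : ℝ) ^ 2 * s ^ 2 = ℓ * ρ := by rw [hs2]; field_simp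
  have hs1 : s ≤ 1 := by
    rw [hs, sqrt_le_one, div_le_one hℓ]
    linarith
  have hθ1 : |θ| < 1 / 2 := by linarith
  have hθpi : |θ| < π / 2 := by linarith [pi_gt_three]
  have hcos : 1 / 2 ≤ cos θ := by
    have h1 := one_sub_sq_div_two_le_cos (x := θ)
    have h2 : θ ^ 2 ≤ 1 := by rw [← sq_abs]; nlinarith [abs_nonneg θ]
    linarith
  have htan : |tan θ| ≤ s / 6 := by
    rw [tan_eq_sin_div_cos, abs_div, abs_of_pos (by linarith : 0 < cos θ), div_le_iff₀ (by linarith)]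
    have := abs_sin_le_abs (x := θ)
    nlinarith
  have htan2 : tan θ ^ 2 ≤ s ^ 2 / 36 := by
    rw [← sq_abs]
    nlinarith [abs_nonneg (tan θ)]
  have hm0 : 14 ≤ (m : ℝ) := by linarith
  have hmt : ((m : ℝ) ^ 2 - 1 / 4) * tan θ ^ 2 ≤ ℓ * ρ / 36 := by
    have h1 : (m : ℝ) ^ 2 - 1 / 4 ≤ (ℓ : ℝ) ^ 2 := by nlinarith
    calc _ ≤ (ℓ : ℝ) ^ 2 * (s ^ 2 / 36) := mul_le_mul h1 htan2 (sq_nonneg _) (sq_nonneg _)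
      _ = _ := by rw [← hsℓ]; ring
  have hmt0 : 0 ≤ ((m : ℝ) ^ 2 - 1 / 4) * tan θ ^ 2 := mul_nonneg (by nlinarith) (sq_nonneg _)
  have hm_sq_le : (m : ℝ) ^ 2 ≤ (ℓ - ρ) ^ 2 := by nlinarith
  have hle_m_sq : (ℓ - 2 * ρ) ^ 2 ≤ (m : ℝ) ^ 2 := by nlinarith
  rw [Qlm_eq_tan ℓ m (by linarith : cos θ ≠ 0)]
  refine ⟨hθpi, ?_, ?_, ?_⟩
  · rw [sq_sqrt (by positivity)]
    nlinarith
  · rw [mul_pow, sq_sqrt (by positivity)]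
    nlinarith
  · rw [hsK]
    calc (2 * (m : ℝ) + 1) * |tan θ| ≤ (3 * ℓ) * (s / 6) :=
          mul_le_mul (by linarith) htan (abs_nonneg _) (by positivity)
      _ = _ := by ring

theorem Qlm_bounds_away_from_poles {ℓ : ℕ} {m : ℤ} {ρ θ : ℝ} (hρ : 1 ≤ ρ) (hℓ : (1 : ℝ) ≤ ℓ)
    (hm₁ : ρ ≤ m) (hm₂ : (m : ℝ) < 2 * ρ) (hθ : |θ| < π / 2 - 10 * π * ρ / ℓ) :
    |θ| < π / 2 ∧ ((ℓ : ℝ) / 2) ^ 2 ≤ -Qlm ℓ m θ ∧ -Qlm ℓ m θ ≤ (4 * ((ℓ : ℝ) / 2)) ^ 2 ∧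
      (2 * (m : ℝ) + 1) * |tan θ| ≤ (ℓ : ℝ) / 2 / 2 := by
  have hℓ0 : (0 : ℝ) < ℓ := by linarith
  have hθpi : |θ| < π / 2 := hθ.trans_le (sub_le_self _ (by positivity))
  have hcos : 20 * ρ / ℓ ≤ cos θ := by
    have h := mul_le_sin (x := π / 2 - |θ|) (by linarith) (by linarith [abs_nonneg θ])
    rw [sin_pi_div_two_sub, cos_abs] at h
    calc 20 * ρ / ℓ = 2 / π * (10 * π * ρ / ℓ) := by field_simp; norm_num
      _ ≤ 2 / π * (π / 2 - |θ|) := by gcongr; linarith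
      _ ≤ _ := h
  have hcos0 : 0 < cos θ := lt_of_lt_of_le (by positivity) hcos
  rw [div_le_iff₀ hℓ0] at hcos
  have htan : |tan θ| * (20 * ρ) ≤ ℓ := by
    have h1 : |tan θ| * cos θ ≤ 1 := by
      have h2 := abs_sin_le_one θ
      rwa [← tan_mul_cos hcos0.ne', abs_mul, abs_of_pos hcos0] at h2
    calc |tan θ| * (20 * ρ) ≤ |tan θ| * (cos θ * ℓ) := by gcongr
      _ = |tan θ| * cos θ * ℓ := by ring
      _ ≤ 1 * ℓ := by gcongr
      _ = ℓ := one_mul _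
  have hquot : ((m : ℝ) ^ 2 - 1 / 4) / cos θ ^ 2 ≤ (ℓ : ℝ) ^ 2 / 100 := by
    rw [div_le_iff₀ (by positivity)]
    have h1 : (20 * ρ) ^ 2 ≤ (cos θ * ℓ) ^ 2 := by gcongr
    nlinarith
  have hquot0 : 0 ≤ ((m : ℝ) ^ 2 - 1 / 4) / cos θ ^ 2 := div_nonneg (by nlinarith) (sq_nonneg _)
  refine ⟨hθpi, ?_, ?_, ?_⟩
  · unfold Qlm
    nlinarith
  · unfold Qlm
    nlinarith
  · calc (2 * (m : ℝ) + 1) * |tan θ| ≤ (5 * ρ) * |tan θ| := by gcongr; linarith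
      _ = (|tan θ| * (20 * ρ)) / 4 := by ring
      _ ≤ ℓ / 4 := by gcongr
      _ = _ := by ring

/-- Control of the oscillations: lower bound for sums of squares of WKB approximations. -/
theorem stmt_14 (r : ℕ → ℝ) (hrpos : ∀ ℓ, 0 < r ℓ)
    (hrinf : Tendsto r atTop atTop)
    (hr0 : Tendsto (fun ℓ : ℕ => r ℓ / (ℓ : ℝ)) atTop (nhds 0))
    (A : ℝ) (hA : 1 ≤ A) :
    ∃ η₁ > (0:ℝ), ∃ η₂ > (0:ℝ), ∃ c > (0:ℝ), ∃ L : ℕ, 1 ≤ L ∧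
      ∀ ℓ : ℕ, L ≤ ℓ → ∀ (M : Finset ℤ) (I : Set ℝ),
        (((∀ m : ℤ, m ∈ M ↔ ((ℓ : ℝ) - 2 * r ℓ < (m : ℝ) ∧ (m : ℝ) ≤ (ℓ : ℝ) - r ℓ)) ∧
            I = Set.Ioo (-(η₂ * Real.sqrt (r ℓ / (ℓ : ℝ)))) (η₂ * Real.sqrt (r ℓ / (ℓ : ℝ)))) ∨
          ((∀ m : ℤ, m ∈ M ↔ (r ℓ ≤ (m : ℝ) ∧ (m : ℝ) < 2 * r ℓ)) ∧
            I = Set.Ioo (-(π / 2 - η₁ * r ℓ / (ℓ : ℝ))) (π / 2 - η₁ * r ℓ / (ℓ : ℝ)))) →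
        ∀ cm : ℤ → ℂ,
          (∀ m ∈ M, A⁻¹ * (ℓ : ℝ) ≤ ‖cm m‖ ^ 2 ∧ ‖cm m‖ ^ 2 ≤ A * (ℓ : ℝ)) →
        ∀ θ ∈ I,
          c * ∑ m ∈ M, ‖cm m‖ ^ 2 * |Qlm ℓ m θ| ^ (-(1:ℝ) / 2) ≤
            ∑ m ∈ M, ‖cm m * ((ylm ℓ m θ : ℝ) : ℂ)‖ ^ 2 := by
  have hev : ∀ᶠ ℓ : ℕ in atTop, 3 ≤ r ℓ ∧ r ℓ / (ℓ : ℝ) ≤ 1 / 16 ∧ 1 ≤ ℓ :=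
    (hrinf.eventually_ge_atTop 3).and
      ((hr0.eventually_le_const (by norm_num)).and (eventually_ge_atTop 1))
  obtain ⟨L, hL⟩ := eventually_atTop.1 hev
  refine ⟨10 * π, by positivity, 1 / 12, by norm_num, 1 / (8 * A ^ 2 * 4), by positivity,
    max L 1, le_max_right _ _, ?_⟩
  intro ℓ hℓ M I hMI cm hcm θ hθ
  obtain ⟨hr3, hrℓ, hℓ1⟩ := hL ℓ ((le_max_left _ _).trans hℓ)
  have hℓ1' : (1 : ℝ) ≤ ℓ := by exact_mod_cast hℓ1
  have hρℓ : 16 * r ℓ ≤ ℓ := by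
    rw [div_le_iff₀ (by linarith)] at hrℓ
    linarith
  rcases hMI with ⟨hM, rfl⟩ | ⟨hM, rfl⟩
  · have hb : ∀ m ∈ M, _ := fun m hm =>
      Qlm_bounds_near_equator (by linarith) hρℓ ((hM m).1 hm).1 ((hM m).1 hm).2 (abs_lt.2 hθ)
    obtain rfl : M = Finset.Ico (⌊(ℓ : ℝ) - 2 * r ℓ⌋ + 1) (⌊(ℓ : ℝ) - r ℓ⌋ + 1) := by
      ext m
      rw [hM, Finset.mem_Ico, Int.add_one_le_iff, Int.lt_add_one_iff, Int.floor_lt, Int.le_floor]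
    have hp : 0 ≤ ⌊(ℓ : ℝ) - 2 * r ℓ⌋ := Int.floor_nonneg.2 (by linarith)
    have hpq : ⌊(ℓ : ℝ) - 2 * r ℓ⌋ + 2 ≤ ⌊(ℓ : ℝ) - r ℓ⌋ := by
      rw [Int.le_floor]
      push_cast
      linarith [Int.floor_le ((ℓ : ℝ) - 2 * r ℓ)]
    have hmem := Finset.left_mem_Ico.2 (by omega :
      ⌊(ℓ : ℝ) - 2 * r ℓ⌋ + 1 < ⌊(ℓ : ℝ) - r ℓ⌋ + 1)
    exact sum_sq_norm_mul_ylm_ge (by omega) (by omega) (by linarith) (by norm_num)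
      (sqrt_pos.2 (by nlinarith)) (hb _ hmem).1 (fun m hm => ⟨(hb m hm).2.1, (hb m hm).2.2.1⟩)
      (fun m hm => (hb m hm).2.2.2) hcm
  · have hb : ∀ m ∈ M, _ := fun m hm =>
      Qlm_bounds_away_from_poles (by linarith) hℓ1' ((hM m).1 hm).1 ((hM m).1 hm).2 (abs_lt.2 hθ)
    obtain rfl : M = Finset.Ico ⌈r ℓ⌉ ⌈2 * r ℓ⌉ := by
      ext m
      rw [hM, Finset.mem_Ico, Int.ceil_le, Int.lt_ceil]
    have hp : 0 < ⌈r ℓ⌉ := Int.ceil_pos.2 (by linarith)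
    have hpq : ⌈r ℓ⌉ + 2 ≤ ⌈2 * r ℓ⌉ := by
      have h : ⌈r ℓ⌉ + 1 < ⌈2 * r ℓ⌉ := by
        rw [Int.lt_ceil]
        push_cast
        linarith [Int.ceil_lt_add_one (r ℓ)]
      omega
    have hmem := Finset.left_mem_Ico.2 (by omega : ⌈r ℓ⌉ < ⌈2 * r ℓ⌉)
    exact sum_sq_norm_mul_ylm_ge (by omega) hpq (by linarith) (by norm_num)
      (by linarith) (hb _ hmem).1 (fun m hm => ⟨(hb m hm).2.1, (hb m hm).2.2.1⟩)
      (fun m hm => (hb m hm).2.2.2) hcm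
end
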